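/- arXiv:2601.00179 — 2 statements merged into one kernel-verified Lean document; each statement's English description precedes it below -/
import Mathlib

section
/- For every integer K ≥ 1, the set of all φ ∈ C(𝒞,𝒞) such that φ is a homeomorphism of 𝒞 having exactly K ergodic φ-invariant Borel probability measures is a Borel subset of the Polish space C(𝒞,𝒞). -/
open MeasureTheory TopologicalSpace Topology

/-- The Cantor space `Bool^ℤ`. -/
abbrev Cantor : Type := ℤ → Bool

/-- The two-sided orbit `{φ^k x : k ∈ ℤ}` of a point under a bijection `φ`. -/
def zOrbit {X : Type*} (φ : X → X) (x : X) : Set X :=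
  {y | ∃ n : ℕ, φ^[n] x = y ∨ φ^[n] y = x}

/-- A Borel probability measure is `φ`-invariant. -/
def InvariantProb {X : Type*} [MeasurableSpace X] (φ : X → X)
    (μ : ProbabilityMeasure X) : Prop :=
  ∀ B : Set X, MeasurableSet B → μ.toMeasure (φ ⁻¹' B) = μ.toMeasure B

/-- A Borel probability measure is ergodic for `φ`. -/
def ErgodicProb {X : Type*} [MeasurableSpace X] (φ : X → X)
    (μ : ProbabilityMeasure X) : Prop :=
  InvariantProb φ μ ∧ ∀ B : Set X, MeasurableSet B → φ ⁻¹' B = B →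
    μ.toMeasure B = 0 ∨ μ.toMeasure B = 1

noncomputable instance : MeasurableSpace C(Cantor, Cantor) := borel _
instance : BorelSpace C(Cantor, Cantor) := ⟨rfl⟩

open Set Function
open scoped ENNReal NNReal

/-- Linear independence of a finite family is an open condition in a Hausdorff topological vector
space. -/
theorem isOpen_setOf_linearIndependent_of_t2 {ι E : Type*} [Fintype ι] [AddCommGroup E]
    [Module ℝ E] [TopologicalSpace E] [ContinuousAdd E] [ContinuousSMul ℝ E] [T2Space E] :
    IsOpen {v : ι → E | LinearIndependent ℝ v} := by
  have hclosed : IsClosed {p : (ι → E) × Metric.sphere (0 : ι → ℝ) 1 |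
      ∑ i, (p.2 : ι → ℝ) i • p.1 i = 0} :=
    isClosed_eq (continuous_finsetSum _ fun i _ =>
      (((continuous_apply i).comp (continuous_subtype_val.comp continuous_snd)).smul
        ((continuous_apply i).comp continuous_fst))) continuous_const
  convert (isClosedMap_fst_of_compactSpace _ hclosed).isOpen_compl using 1
  ext v
  rw [mem_ofPred_eq, mem_compl_iff, ← not_iff_not, not_not, Fintype.not_linearIndependent_iff]
  constructor
  · rintro ⟨g, hg, i, hi⟩
    have hg0 : ‖g‖ ≠ 0 := fun h => hi (by simp [norm_eq_zero.1 h])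
    refine ⟨(v, ⟨‖g‖⁻¹ • g, by simp [norm_smul, hg0]⟩), ?_, rfl⟩
    simp [mul_smul, ← Finset.smul_sum, hg]
  · rintro ⟨⟨w, g, hg⟩, h, rfl⟩
    refine ⟨g, h, ?_⟩
    by_contra! h0
    have : g = 0 := funext h0
    simp [this] at hg

theorem invariantProb_iff_measurePreserving {X : Type*} [MeasurableSpace X] {φ : X → X}
    (hφ : Measurable φ) (μ : ProbabilityMeasure X) :
    InvariantProb φ μ ↔ MeasurePreserving φ (μ : Measure X) μ := by
  refine ⟨fun h => ⟨hφ, Measure.ext fun B hB => ?_⟩, fun h B hB => ?_⟩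
  · rw [Measure.map_apply hφ hB, h B hB]
  · exact h.measure_preimage hB.nullMeasurableSet

theorem ergodicProb_iff_ergodic {X : Type*} [MeasurableSpace X] {φ : X → X}
    (hφ : Measurable φ) (μ : ProbabilityMeasure X) :
    ErgodicProb φ μ ↔ Ergodic φ (μ : Measure X) := by
  rw [ErgodicProb, invariantProb_iff_measurePreserving hφ]
  refine ⟨fun h => ⟨h.1, ⟨fun B hB hφB => ?_⟩⟩,
    fun h => ⟨h.toMeasurePreserving, fun B hB hφB => h.prob_eq_zero_or_one hB hφB⟩⟩
  rw [Filter.eventuallyConst_set]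
  rcases h.2 B hB hφB with h0 | h1
  · exact .inr (measure_eq_zero_iff_ae_notMem.1 h0)
  · exact .inl ((prob_compl_eq_zero_iff hB).2 h1)

namespace MeasureTheory

/-- Distinct ergodic probability measures of the same map are mutually singular. -/
theorem mutuallySingular_of_ergodic {X : Type*} [MeasurableSpace X] {f : X → X}
    {μ ν : Measure X} [IsProbabilityMeasure μ] [IsProbabilityMeasure ν]
    (hμ : Ergodic f μ) (hν : Ergodic f ν) (hne : μ ≠ ν) : ν ⟂ₘ μ := by
  have hinv := hν.toMeasurePreserving.withDensity_rnDeriv hμ.toMeasurePreserving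
  have hle := Measure.withDensity_rnDeriv_le ν μ
  have : IsFiniteMeasure (μ.withDensity (ν.rnDeriv μ)) := isFiniteMeasure_of_le ν hle
  obtain ⟨c, hc⟩ := hμ.eq_smul_of_absolutelyContinuous hinv (withDensity_absolutelyContinuous _ _)
  rcases eq_or_ne c 0 with rfl | h0
  · have h := Measure.rnDeriv_add_singularPart ν μ
    rw [hc, zero_smul, zero_add] at h
    exact h ▸ Measure.mutuallySingular_singularPart ν μ
  · refine absurd (hν.eq_of_absolutelyContinuous hμ.toMeasurePreserving ?_) hne
    exact (Measure.absolutelyContinuous_smul h0).trans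
      (hc ▸ Measure.absolutelyContinuous_of_le hle)

namespace ProbabilityMeasure

variable {X : Type*} [TopologicalSpace X] [MeasurableSpace X]

/-- A probability measure as a functional on continuous functions. -/
noncomputable def integralVec (μ : ProbabilityMeasure X) : C(X, ℝ) → ℝ := fun f => ∫ x, f x ∂μ

@[simp]
theorem integralVec_apply (μ : ProbabilityMeasure X) (f : C(X, ℝ)) :
    μ.integralVec f = ∫ x, f x ∂μ := rfl

variable [BorelSpace X]

section Metrizable

variable [MetrizableSpace X]

theorem ext_of_forall_integral_continuousMap_eq {μ ν : Measure X} [IsFiniteMeasure μ]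
    [IsFiniteMeasure ν] (h : ∀ f : C(X, ℝ), ∫ x, f x ∂μ = ∫ x, f x ∂ν) : μ = ν :=
  ext_of_forall_integral_eq_of_IsFiniteMeasure fun f => h f.toContinuousMap

theorem integralVec_injective : Injective (integralVec (X := X)) := fun _ _ h =>
  toMeasure_injective (ext_of_forall_integral_continuousMap_eq (congrFun h))

theorem invariantProb_iff_integral (φ : C(X, X)) (μ : ProbabilityMeasure X) :
    InvariantProb φ μ ↔ ∀ f : C(X, ℝ), ∫ x, f.comp φ x ∂μ = ∫ x, f x ∂μ := by
  have hφ := φ.continuous.measurable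
  have hmap (f : C(X, ℝ)) : ∫ x, f x ∂(Measure.map φ μ) = ∫ x, f.comp φ x ∂μ :=
    integral_map hφ.aemeasurable f.continuous.aestronglyMeasurable
  rw [invariantProb_iff_measurePreserving hφ]
  refine ⟨fun h f => by rw [← hmap, h.map_eq], fun h => ⟨hφ, ?_⟩⟩
  have := Measure.isProbabilityMeasure_map (μ := (μ : Measure X)) hφ.aemeasurable
  exact ext_of_forall_integral_continuousMap_eq fun f => (hmap f).trans (h f)

end Metrizable

variable [CompactSpace X]

theorem integrable_continuousMap (f : C(X, ℝ)) (μ : Measure X) [IsFiniteMeasure μ] :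
    Integrable f μ :=
  f.continuous.integrable_of_hasCompactSupport (.of_compactSpace f)

theorem continuous_integralVec : Continuous (integralVec (X := X)) :=
  _root_.continuous_pi fun f => continuous_integral_continuousMap f

theorem continuous_integral_prod :
    Continuous fun p : C(X, ℝ) × ProbabilityMeasure X => ∫ x, p.1 x ∂p.2 := by
  refine continuous_prod_of_continuous_lipschitzWith _ 1
    (fun f => continuous_integral_continuousMap f) fun μ => ?_
  refine LipschitzWith.of_dist_le_mul fun f g => ?_
  rw [dist_eq_norm, ← integral_sub (integrable_continuousMap f μ) (integrable_continuousMap g μ)]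
  refine (norm_integral_le_of_norm_le_const (C := dist f g) (.of_forall fun x => ?_)).trans ?_
  · rw [← dist_eq_norm]
    exact ContinuousMap.dist_apply_le_dist x
  · simp

theorem convex_integralVec_image_invariantProb (φ : C(X, X)) :
    Convex ℝ (integralVec '' {μ | InvariantProb φ μ}) := by
  rintro _ ⟨μ, hμ, rfl⟩ _ ⟨ν, hν, rfl⟩ a b ha hb hab
  let ρ : Measure X := a.toNNReal • (μ : Measure X) + b.toNNReal • (ν : Measure X)
  have hρ : IsProbabilityMeasure ρ := ⟨by
    simp only [ρ, Measure.add_apply, Measure.smul_apply, measure_univ, ENNReal.smul_def,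
      smul_eq_mul, mul_one]
    rw [← ENNReal.coe_add, ← Real.toNNReal_add ha hb, hab, Real.toNNReal_one, ENNReal.coe_one]⟩
  refine ⟨⟨ρ, hρ⟩, fun B hB => ?_, ?_⟩
  · change ρ (φ ⁻¹' B) = ρ B
    simp only [ρ, Measure.add_apply, Measure.smul_apply, hμ B hB, hν B hB]
  · ext f
    change ∫ x, f x ∂ρ = _
    simp [ρ, integral_add_measure (integrable_continuousMap f _) (integrable_continuousMap f _),
      integral_smul_nnreal_measure, NNReal.smul_def, ha, hb]

variable [MetrizableSpace X]

theorem linearIndependent_integralVec_of_mutuallySingular {ι : Type*} [Fintype ι]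
    {μ : ι → ProbabilityMeasure X}
    (hμ : Pairwise fun i j => (μ i : Measure X) ⟂ₘ (μ j : Measure X)) :
    LinearIndependent ℝ fun i => (μ i).integralVec := by
  rw [Fintype.linearIndependent_iff]
  intro g hg i
  have heq : ∑ j, (g j).toNNReal • (μ j : Measure X) =
      ∑ j, (-g j).toNNReal • (μ j : Measure X) := by
    refine ext_of_forall_integral_continuousMap_eq fun f => ?_
    rw [integral_finsetSum_measure fun j _ => integrable_continuousMap f _,
      integral_finsetSum_measure fun j _ => integrable_continuousMap f _,
      ← sub_eq_zero, ← Finset.sum_sub_distrib]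
    simpa [integral_smul_nnreal_measure, NNReal.smul_def, ← sub_mul,
      max_zero_sub_max_neg_zero_eq_self]
      using congrFun hg f
  have hex : ∀ j, ∃ s, (μ i : Measure X) sᶜ = 0 ∧ (j ≠ i → (μ j : Measure X) s = 0) := fun j => by
    rcases eq_or_ne j i with rfl | hj
    · exact ⟨univ, by simp⟩
    · exact ⟨(hμ hj).nullSet, (hμ hj).measure_compl_nullSet, fun _ => (hμ hj).measure_nullSet⟩
  choose s hs hs' using hex
  have hT (j) (hj : j ≠ i) : (μ j : Measure X) (⋂ k, s k) = 0 :=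
    measure_mono_null (iInter_subset s j) (hs' j hj)
  have hTi : (μ i : Measure X) (⋂ k, s k) ≠ 0 := fun h => by
    have hc : (μ i : Measure X) (⋂ k, s k)ᶜ = 0 := by
      rw [compl_iInter]
      exact measure_iUnion_null hs
    have := measure_union_null h hc
    rw [union_compl_self, measure_univ] at this
    exact one_ne_zero this
  have h := congrArg (fun ν : Measure X => ν (⋂ k, s k)) heq
  simp only [Measure.finsetSum_apply, Measure.smul_apply] at h
  rw [Finset.sum_eq_single i (by simp +contextual [hT]) (by simp),
    Finset.sum_eq_single i (by simp +contextual [hT]) (by simp)] at h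
  simp only [ENNReal.smul_def, smul_eq_mul] at h
  rw [ENNReal.mul_left_inj hTi (measure_ne_top _ _), ENNReal.coe_inj] at h
  have h' := congrArg NNReal.toReal h
  rw [Real.coe_toNNReal', Real.coe_toNNReal', ← sub_eq_zero] at h'
  rwa [← max_zero_sub_max_neg_zero_eq_self (g i)]

theorem isClosed_setOf_invariantProb :
    IsClosed {p : C(X, X) × ProbabilityMeasure X | InvariantProb p.1 p.2} := by
  simp only [invariantProb_iff_integral, ofPred_forall]
  refine isClosed_iInter fun f => isClosed_eq ?_ ?_
  · exact continuous_integral_prod.comp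
      (((ContinuousMap.continuous_postcomp f).comp continuous_fst).prodMk continuous_snd)
  · exact (continuous_integral_continuousMap f).comp continuous_snd

theorem exists_ergodicProb_of_mem_extremePoints (φ : C(X, X)) {v : C(X, ℝ) → ℝ}
    (hv : v ∈ (integralVec '' {μ | InvariantProb φ μ}).extremePoints ℝ) :
    v ∈ integralVec '' {μ | ErgodicProb φ μ} := by
  obtain ⟨⟨μ, hμ, rfl⟩, hext⟩ := hv
  have hφ := φ.continuous.measurable
  refine ⟨μ, (ergodicProb_iff_ergodic hφ μ).2 (.of_mem_extremePoints ?_), rfl⟩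
  refine ⟨⟨(invariantProb_iff_measurePreserving hφ μ).1 hμ, inferInstance⟩, ?_⟩
  rintro ν₁ ⟨hν₁, hp₁⟩ ν₂ ⟨hν₂, hp₂⟩ ⟨a, b, ha, hb, hab, hμab⟩
  have ha' : a ≠ ∞ := fun h => by simp [h] at hab
  have hb' : b ≠ ∞ := fun h => by simp [h] at hab
  let P₁ : ProbabilityMeasure X := ⟨ν₁, hp₁⟩
  let P₂ : ProbabilityMeasure X := ⟨ν₂, hp₂⟩
  have h := hext (mem_image_of_mem _ ((invariantProb_iff_measurePreserving hφ P₁).2 hν₁))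
    (mem_image_of_mem _ ((invariantProb_iff_measurePreserving hφ P₂).2 hν₂))
    ⟨a.toReal, b.toReal, ENNReal.toReal_pos ha.ne' ha', ENNReal.toReal_pos hb.ne' hb',
      by rw [← ENNReal.toReal_add ha' hb', hab, ENNReal.toReal_one], ?_⟩
  · exact congrArg toMeasure (integralVec_injective h)
  · ext f
    rw [integralVec_apply, ← hμab,
      integral_add_measure ((integrable_continuousMap f ν₁).smul_measure ha')
        ((integrable_continuousMap f ν₂).smul_measure hb'),
      integral_smul_measure, integral_smul_measure]
    rfl

/-- A continuous self-map of a compact metrizable space has at least `n` ergodic probability measures iff it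
has `n` linearly independent invariant probability measures. -/
theorem le_encard_ergodicProb_iff (φ : C(X, X)) (n : ℕ) :
    n ≤ {μ : ProbabilityMeasure X | ErgodicProb φ μ}.encard ↔
      ∃ μ : Fin n → ProbabilityMeasure X, (∀ i, InvariantProb φ (μ i)) ∧
        LinearIndependent ℝ fun i => (μ i).integralVec := by
  have hφ := φ.continuous.measurable
  constructor
  · intro h
    obtain ⟨t, ht, htn⟩ := exists_subset_encard_eq h
    obtain ⟨e⟩ : Nonempty (Fin n ≃ t) := by
      have : Finite t := finite_of_encard_eq_coe htn
      refine ⟨(Finite.equivFinOfCardEq ?_).symm⟩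
      rw [Nat.card_coe_set_eq, ncard_def, htn, ENat.toNat_natCast]
    refine ⟨fun i => e i, fun i => (ht (e i).2).1, ?_⟩
    refine linearIndependent_integralVec_of_mutuallySingular fun i j hij => ?_
    refine mutuallySingular_of_ergodic ((ergodicProb_iff_ergodic hφ _).1 (ht (e j).2))
      ((ergodicProb_iff_ergodic hφ _).1 (ht (e i).2)) fun h => hij ?_
    exact (e.injective (Subtype.ext (toMeasure_injective h))).symm
  · rintro ⟨μ, hμ, hli⟩
    by_contra! hlt
    have hfin : {μ : ProbabilityMeasure X | ErgodicProb φ μ}.Finite :=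
      finite_of_encard_le_coe hlt.le
    set E : Set (C(X, ℝ) → ℝ) := integralVec '' {μ | ErgodicProb φ μ}
    have hEfin : E.Finite := hfin.image _
    have hcomp : IsCompact (integralVec '' {μ : ProbabilityMeasure X | InvariantProb φ μ}) :=
      (isClosed_setOf_invariantProb.preimage (.prodMk_right φ)).isCompact.image
        continuous_integralVec
    have hsub : integralVec '' {μ : ProbabilityMeasure X | InvariantProb φ μ} ⊆
        Submodule.span ℝ E := by
      rw [← closure_convexHull_extremePoints hcomp (convex_integralVec_image_invariantProb φ)]
      refine (closure_mono (convexHull_mono fun v =>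
        exists_ergodicProb_of_mem_extremePoints φ)).trans ?_
      rw [(hEfin.isClosed_convexHull ℝ).closure_eq]
      exact convexHull_min Submodule.subset_span (Submodule.convex _)
    have := hEfin.fintype
    have hle := linearIndependent_le_span' _ hli E
      (range_subset_iff.2 fun i => hsub (mem_image_of_mem _ (hμ i)))
    rw [Cardinal.mk_fin, Nat.cast_le, ← Nat.card_eq_fintype_card,
      Nat.card_coe_set_eq] at hle
    rw [← hfin.cast_ncard_eq, Nat.cast_lt] at hlt
    exact absurd (hle.trans (ncard_image_le hfin)) hlt.not_ge

theorem measurableSet_le_encard_ergodicProb [MeasurableSpace C(X, X)] [BorelSpace C(X, X)]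
    (n : ℕ) :
    MeasurableSet {φ : C(X, X) | n ≤ {μ : ProbabilityMeasure X | ErgodicProb φ μ}.encard} := by
  have hopen : IsOpen {μ : Fin n → ProbabilityMeasure X |
      LinearIndependent ℝ fun i => (μ i).integralVec} :=
    isOpen_setOf_linearIndependent_of_t2.preimage
      (_root_.continuous_pi fun i => continuous_integralVec.comp (continuous_apply i))
  let := metrizableSpaceMetric (Fin n → ProbabilityMeasure X)
  obtain ⟨F, hFc, -, hF, -⟩ := hopen.exists_iUnion_isClosed
  have hinv : IsClosed {p : C(X, X) × (Fin n → ProbabilityMeasure X) |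
      ∀ i, InvariantProb p.1 (p.2 i)} := by
    simp only [ofPred_forall]
    refine isClosed_iInter fun i => ?_
    have hc : Continuous fun p : C(X, X) × (Fin n → ProbabilityMeasure X) => (p.1, p.2 i) :=
      continuous_fst.prodMk ((continuous_apply i).comp continuous_snd)
    exact isClosed_setOf_invariantProb.preimage hc
  convert MeasurableSet.iUnion fun k => (isClosedMap_fst_of_compactSpace _
    (hinv.inter ((hFc k).preimage continuous_snd))).measurableSet using 1
  ext φ
  rw [mem_ofPred_eq, le_encard_ergodicProb_iff]
  have hmem (μ : Fin n → ProbabilityMeasure X) :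
      (LinearIndependent ℝ fun i => (μ i).integralVec) ↔ ∃ k, μ ∈ F k := by
    rw [← mem_iUnion, hF, mem_ofPred_eq]
  simp only [hmem]
  simp
  grind

end ProbabilityMeasure

end MeasureTheory

theorem isHomeomorph_iff_injective_surjective {X Y : Type*} [TopologicalSpace X]
    [TopologicalSpace Y] [CompactSpace X] [T2Space Y] (φ : C(X, Y)) :
    IsHomeomorph φ ↔ Injective φ ∧ Surjective φ := by
  rw [isHomeomorph_iff_continuous_bijective]
  exact and_iff_right φ.continuous

theorem isClosed_setOf_surjective {X Y : Type*} [TopologicalSpace X] [TopologicalSpace Y]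
    [CompactSpace X] [T2Space Y] : IsClosed {φ : C(X, Y) | Surjective φ} := by
  simp only [Surjective, ofPred_forall]
  refine isClosed_iInter fun y => ?_
  have hc : IsClosed {p : C(X, Y) × X | p.1 p.2 = y} :=
    isClosed_eq (by fun_prop) continuous_const
  convert isClosedMap_fst_of_compactSpace _ hc using 1
  ext φ
  simp

theorem measurableSet_setOf_injective {X Y : Type*} [TopologicalSpace X] [TopologicalSpace Y]
    [CompactSpace X] [MetrizableSpace X] [T2Space Y] [MeasurableSpace C(X, Y)]
    [BorelSpace C(X, Y)] : MeasurableSet {φ : C(X, Y) | Injective φ} := by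
  let := metrizableSpaceMetric (X × X)
  obtain ⟨F, hFc, -, hF, -⟩ := (isClosed_diagonal (X := X)).isOpen_compl.exists_iUnion_isClosed
  have hc : IsClosed {p : C(X, Y) × (X × X) | p.1 p.2.1 = p.1 p.2.2} :=
    isClosed_eq (by fun_prop) (by fun_prop)
  convert (MeasurableSet.iUnion fun k => (isClosedMap_fst_of_compactSpace _
    (hc.inter ((hFc k).preimage continuous_snd))).measurableSet).compl using 1
  ext φ
  have hmem (x y : X) : x ≠ y ↔ ∃ k, (x, y) ∈ F k := by
    rw [← mem_iUnion, hF, mem_compl_iff, mem_diagonal_iff]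
  have hne : (∃ k x y, φ x = φ y ∧ (x, y) ∈ F k) ↔ ∃ x y, φ x = φ y ∧ x ≠ y := by
    simp only [hmem]
    tauto
  rw [mem_compl_iff, ← not_iff_not, not_not, mem_ofPred_eq, not_injective_iff, ← hne]
  simp

theorem measurableSet_setOf_isHomeomorph {X : Type*} [TopologicalSpace X] [CompactSpace X]
    [MetrizableSpace X] [MeasurableSpace C(X, X)] [BorelSpace C(X, X)] :
    MeasurableSet {φ : C(X, X) | IsHomeomorph φ} := by
  simp only [isHomeomorph_iff_injective_surjective]
  exact measurableSet_setOf_injective.inter isClosed_setOf_surjective.measurableSet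

theorem Set.ncard_eq_iff_encard {α : Type*} {s : Set α} {n : ℕ} (hn : 1 ≤ n) :
    s.ncard = n ↔ n ≤ s.encard ∧ ¬ (n + 1 : ℕ) ≤ s.encard := by
  rcases s.finite_or_infinite with hs | hs
  · rw [← hs.cast_ncard_eq, Nat.cast_le, Nat.cast_le]
    omega
  · simp [hs.ncard, hs.encard_eq]
    omega

theorem stmt0 (K : ℕ) (hK : 1 ≤ K) :
    MeasurableSet {φ : C(Cantor, Cantor) |
      IsHomeomorph (φ : Cantor → Cantor) ∧
      {μ : ProbabilityMeasure Cantor | ErgodicProb (φ : Cantor → Cantor) μ}.ncard = K} := by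
  simp only [ncard_eq_iff_encard hK]
  exact measurableSet_setOf_isHomeomorph.inter
    ((ProbabilityMeasure.measurableSet_le_encard_ergodicProb K).inter
      (ProbabilityMeasure.measurableSet_le_encard_ergodicProb (K + 1)).compl)
end

section
/- There is a Borel measurable map T from (ℕ → (ℕ → Bool)) to the space of nonempty compact subsets of Bool^ℤ (with the Hausdorff metric and its Borel σ-algebra) such that: (i) for every a, T(a) is a regular Toeplitz subshift of Bool^ℤ; and (ii) for all a, b, a =^+ b if and only if the systems (T(a), σ) and (T(b), σ) are orbit equivalent, where σ denotes the shift. In particular, =^+ is Borel reducible to the orbit equivalence for regular {0,1}-Toeplitz subshifts. -/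
open MeasureTheory TopologicalSpace Topology

/-- The shift map on `A^ℤ`. -/
def shift {A : Type*} : (ℤ → A) → (ℤ → A) := fun x n => x (n + 1)

/-- `x` is a Toeplitz sequence. -/
def IsToeplitz {A : Type*} (x : ℤ → A) : Prop :=
  ∀ k : ℤ, ∃ p : ℕ, 1 ≤ p ∧ ∀ n : ℤ, x (k + n * p) = x k

/-- The density `δ_p(x)` of the `p`-periodic positions of `x` in `{0, …, p-1}`. -/
noncomputable def toeplitzDelta {A : Type*} (x : ℤ → A) (p : ℕ) : ℝ :=
  ({k : ℤ | 0 ≤ k ∧ k < (p : ℤ) ∧ ∀ n : ℤ, x (k + n * p) = x k}.ncard : ℝ) / p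

/-- `x` is a regular Toeplitz sequence. -/
def IsRegularToeplitz {A : Type*} (x : ℤ → A) : Prop :=
  IsToeplitz x ∧ sSup {d : ℝ | ∃ p : ℕ, 1 ≤ p ∧ d = toeplitzDelta x p} = 1

/-- `X ⊆ A^ℤ` is the (regular) Toeplitz subshift generated by a regular Toeplitz sequence. -/
def IsRegularToeplitzSubshift {A : Type*} [TopologicalSpace A] (X : Set (ℤ → A)) : Prop :=
  ∃ x : ℤ → A, IsRegularToeplitz x ∧ X = closure (zOrbit shift x)

/-- Orbit equivalence of two subshifts (with the shift map restricted to them). -/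
def SubshiftOrbitEquivalent {A B : Type*} [TopologicalSpace A] [TopologicalSpace B]
    (X : Set (ℤ → A)) (Y : Set (ℤ → B)) : Prop :=
  ∃ f : X ≃ₜ Y, ∀ x y : X,
    (y : ℤ → A) ∈ zOrbit shift (x : ℤ → A) ↔
      ((f y : ℤ → B) ∈ zOrbit shift (f x : ℤ → B))

noncomputable instance : MetricSpace Cantor := TopologicalSpace.metrizableSpaceMetric Cantor
noncomputable instance : MeasurableSpace (NonemptyCompacts Cantor) := borel _
instance : BorelSpace (NonemptyCompacts Cantor) := ⟨rfl⟩

/-! ### Constant length ordered Bratteli systems -/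

/-- The vertices at stage `n`: one bit for each of the coordinates `0, …, n`. -/
abbrev Vertex (n : ℕ) : Type := Fin (n + 1) → Bool

/-- A sequence of constant length substitutions `Θ n : Vertex (n + 1) → (Vertex n) ^ (N n)` with
constant first and last letters, a recognizability marker, and at least half of the letters of
every word independent of the vertex. -/
structure ToeplitzSystem where
  N : ℕ → ℤ
  Θ : ∀ n, Vertex (n + 1) → ℤ → Vertex n
  firstLetter : ∀ n, Vertex n
  lastLetter : ∀ n, Vertex n
  two_le : ∀ n, 2 ≤ N n
  first : ∀ n V, Θ n V 0 = firstLetter n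
  last : ∀ n V, Θ n V (N n - 1) = lastLetter n
  mark_zero : ∀ n, firstLetter n 0 = true
  mark_one : ∀ n V, Θ n V 1 0 = true
  mark_ne : ∀ n V t, 1 ≤ t → t + 1 < N n → ¬ (Θ n V t 0 = true ∧ Θ n V (t + 1) 0 = true)
  mark_last : ∀ n, lastLetter n 0 = false
  inj : ∀ n V V', (∀ t, 0 ≤ t → t < N n → Θ n V t = Θ n V' t) → V = V'
  occ : ∀ n V U, ∃ t, 0 ≤ t ∧ t < N n ∧ Θ n V t = U
  reg : ∀ n, 2 * {t : ℤ | 0 ≤ t ∧ t < N n ∧ ¬ ∀ V V', Θ n V t = Θ n V' t}.ncard ≤ N n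

namespace ToeplitzSystem

variable (S : ToeplitzSystem)

/-- The path space of a system. -/
def Path : Type :=
  {z : (n : ℕ) → Vertex n × ℤ //
    ∀ n, 0 ≤ (z n).2 ∧ (z n).2 < S.N n ∧ (z n).1 = S.Θ n (z (n + 1)).1 (z n).2}

instance : TopologicalSpace S.Path := instTopologicalSpaceSubtype

variable {S}

namespace Path

/-- The vertex of a path at stage `n`. -/
def vert (z : S.Path) (n : ℕ) : Vertex n := (z.1 n).1

/-- The position inside the word of the vertex at stage `n + 1`. -/
def digit (z : S.Path) (n : ℕ) : ℤ := (z.1 n).2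

theorem digit_nonneg (z : S.Path) (n : ℕ) : 0 ≤ z.digit n := (z.2 n).1

theorem digit_lt (z : S.Path) (n : ℕ) : z.digit n < S.N n := (z.2 n).2.1

theorem vert_eq (z : S.Path) (n : ℕ) : z.vert n = S.Θ n (z.vert (n + 1)) (z.digit n) :=
  (z.2 n).2.2

theorem ext' {z w : S.Path} (h : ∀ n, z.vert n = w.vert n) (h' : ∀ n, z.digit n = w.digit n) :
    z = w :=
  Subtype.ext (funext fun n => Prod.ext (h n) (h' n))

end Path

theorem N_pos (S : ToeplitzSystem) (n : ℕ) : 0 < S.N n := by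
  have := S.two_le n; omega

theorem Θ_congr_of_edge (n : ℕ) {t : ℤ} (ht : t = 0 ∨ t = S.N n - 1) (V V' : Vertex (n + 1)) :
    S.Θ n V t = S.Θ n V' t := by
  rcases ht with rfl | rfl
  · rw [S.first, S.first]
  · rw [S.last, S.last]

theorem carry_cases {t N j : ℤ} {k : ℕ} (h0 : 0 ≤ t) (h1 : t < N) (hN : 2 ≤ N)
    (hj : j.natAbs ≤ k + 1) :
    ((t + j) / N).natAbs ≤ k ∨ (t + j) % N = 0 ∨ (t + j) % N = N - 1 := by
  have hd := Int.emod_add_mul_ediv (t + j) N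
  have hr0 := Int.emod_nonneg (t + j) (by omega : N ≠ 0)
  have hr1 := Int.emod_lt_of_pos (t + j) (by omega : 0 < N)
  generalize (t + j) / N = x at *
  generalize (t + j) % N = r at *
  by_contra! hcon
  obtain ⟨c1, c2, c3⟩ := hcon
  rcases le_or_gt 0 x with hx | hx
  · have h1 : (x - 1) * (N - 1) ≥ 0 := mul_nonneg (by omega) (by omega)
    have h2 : j ≤ x := by omega
    have h3 : (x - 1) * (N - 1) = N * x - x - N + 1 := by ring
    omega
  · have h1 : (-x - 1) * (N - 1) ≥ 0 := mul_nonneg (by omega) (by omega)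
    have h2 : x ≤ j := by omega
    have h3 : (-x - 1) * (N - 1) = - (N * x) + x - N + 1 := by ring
    omega

/-- Bi-infinite letter sequences obeying the same recursion and agreeing at `0` are equal. -/
theorem letters_unique {t : ℕ → ℤ} (h0 : ∀ n, 0 ≤ t n) (h1 : ∀ n, t n < S.N n)
    {G H : ∀ n, ℤ → Vertex n}
    (hG : ∀ n j, G n j = S.Θ n (G (n + 1) ((t n + j) / S.N n)) ((t n + j) % S.N n))
    (hH : ∀ n j, H n j = S.Θ n (H (n + 1) ((t n + j) / S.N n)) ((t n + j) % S.N n))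
    (hz : ∀ n, G n 0 = H n 0) (n : ℕ) (j : ℤ) : G n j = H n j := by
  suffices ∀ k : ℕ, ∀ n j, j.natAbs ≤ k → G n j = H n j from this _ n j le_rfl
  intro k
  induction k with
  | zero => intro n j hj; obtain rfl : j = 0 := by omega
            exact hz n
  | succ k ih =>
    intro n j hj
    rw [hG, hH]
    rcases carry_cases (h0 n) (h1 n) (S.two_le n) hj with h | h
    · rw [ih _ _ h]
    · exact Θ_congr_of_edge n h _ _

namespace Path

/-- Approximation of the letter sequence at stage `n` using `k` further stages. -/
def approx (z : S.Path) : ℕ → (n : ℕ) → ℤ → Vertex n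
  | 0, n, _ => z.vert n
  | k + 1, n, j =>
    S.Θ n (z.approx k (n + 1) ((z.digit n + j) / S.N n)) ((z.digit n + j) % S.N n)

theorem approx_step (z : S.Path) (k n : ℕ) (j : ℤ) : z.approx (k + 1) n j =
    S.Θ n (z.approx k (n + 1) ((z.digit n + j) / S.N n)) ((z.digit n + j) % S.N n) := rfl

theorem approx_zero_right (z : S.Path) (k n : ℕ) : z.approx k n 0 = z.vert n := by
  induction k generalizing n with
  | zero => rfl
  | succ k ih =>
    rw [approx, add_zero, Int.ediv_eq_zero_of_lt (z.digit_nonneg n) (z.digit_lt n),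
      Int.emod_eq_of_lt (z.digit_nonneg n) (z.digit_lt n), ih, ← z.vert_eq]

theorem approx_succ (z : S.Path) (k n : ℕ) (j : ℤ) (hj : j.natAbs ≤ k) :
    z.approx (k + 1) n j = z.approx k n j := by
  induction k generalizing n j with
  | zero => obtain rfl : j = 0 := by omega
            rw [approx_zero_right, approx_zero_right]
  | succ k ih =>
    rw [approx_step, approx_step z k n j]
    rcases carry_cases (z.digit_nonneg n) (z.digit_lt n) (S.two_le n) hj with h | h
    · rw [ih _ _ h]
    · exact Θ_congr_of_edge n h _ _

/-- The bi-infinite sequence of stage `n` letters seen from a path. -/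
def letters (z : S.Path) (n : ℕ) (j : ℤ) : Vertex n := z.approx j.natAbs n j

theorem approx_eq (z : S.Path) {k : ℕ} (n : ℕ) {j : ℤ} (hj : j.natAbs ≤ k) :
    z.approx k n j = z.letters n j := by
  induction k, hj using Nat.le_induction with
  | base => rfl
  | succ k hk ih => rw [approx_succ _ _ _ _ hk, ih]

theorem letters_zero (z : S.Path) (n : ℕ) : z.letters n 0 = z.vert n := rfl

theorem letters_eq (z : S.Path) (n : ℕ) (j : ℤ) :
    z.letters n j = S.Θ n (z.letters (n + 1) ((z.digit n + j) / S.N n))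
      ((z.digit n + j) % S.N n) := by
  rw [← z.approx_eq n (Nat.le_succ j.natAbs), approx]
  rcases carry_cases (z.digit_nonneg n) (z.digit_lt n) (S.two_le n) (Nat.le_succ j.natAbs)
    with h | h
  · rw [approx_eq _ _ h]
  · exact Θ_congr_of_edge n h _ _

theorem letters_block (z : S.Path) (n : ℕ) (i s : ℤ) (h0 : 0 ≤ s) (h1 : s < S.N n) :
    z.letters n (i * S.N n + s - z.digit n) = S.Θ n (z.letters (n + 1) i) s := by
  have hN := S.N_pos n
  rw [letters_eq, show z.digit n + (i * S.N n + s - z.digit n) = s + i * S.N n by ring,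
    Int.add_mul_ediv_right _ _ hN.ne', Int.add_mul_emod_self_right, Int.ediv_eq_zero_of_lt h0 h1,
    Int.emod_eq_of_lt h0 h1, zero_add]

/-- The marker recognizes the beginnings of the words. -/
theorem mark_iff (z : S.Path) (n : ℕ) (j : ℤ) :
    (z.letters n j 0 = true ∧ z.letters n (j + 1) 0 = true) ↔ (z.digit n + j) % S.N n = 0 := by
  have hN := S.N_pos n
  have hN2 := S.two_le n
  obtain ⟨i, s, h0, h1, rfl⟩ : ∃ i s, 0 ≤ s ∧ s < S.N n ∧ j = i * S.N n + s - z.digit n :=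
    ⟨(z.digit n + j) / S.N n, (z.digit n + j) % S.N n, Int.emod_nonneg _ hN.ne',
      Int.emod_lt_of_pos _ hN, by
        have := Int.emod_add_mul_ediv (z.digit n + j) (S.N n); linarith⟩
  rw [show z.digit n + (i * S.N n + s - z.digit n) = s + i * S.N n by ring,
    Int.add_mul_emod_self_right, Int.emod_eq_of_lt h0 h1, letters_block _ _ _ _ h0 h1]
  constructor
  · rintro ⟨ha, hb⟩
    by_contra hs
    rcases eq_or_ne s (S.N n - 1) with rfl | hs'
    · rw [S.last, S.mark_last] at ha
      exact absurd ha (by decide)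
    · rw [show i * S.N n + s - z.digit n + 1 = i * S.N n + (s + 1) - z.digit n by ring,
        letters_block _ _ _ _ (by omega) (by omega)] at hb
      exact S.mark_ne n _ s (by omega) (by omega) ⟨ha, hb⟩
  · rintro rfl
    rw [show i * S.N n + 0 - z.digit n + 1 = i * S.N n + 1 - z.digit n by ring,
        letters_block _ _ _ _ (by omega) (by omega), S.first]
    exact ⟨S.mark_zero n, S.mark_one n _⟩

/-- The carry sequence for translating a path by `k`. -/
def carry (z : S.Path) (k : ℤ) : ℕ → ℤ
  | 0 => k
  | n + 1 => (z.digit n + z.carry k n) / S.N n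

/-- The action of the integers on paths. -/
def act (k : ℤ) (z : S.Path) : S.Path :=
  ⟨fun n => (z.letters n (z.carry k n), (z.digit n + z.carry k n) % S.N n), fun n =>
    ⟨Int.emod_nonneg _ (S.N_pos n).ne', Int.emod_lt_of_pos _ (S.N_pos n), z.letters_eq n _⟩⟩

theorem vert_act (k : ℤ) (z : S.Path) (n : ℕ) :
    (act k z).vert n = z.letters n (z.carry k n) := rfl

theorem digit_act (k : ℤ) (z : S.Path) (n : ℕ) :
    (act k z).digit n = (z.digit n + z.carry k n) % S.N n := rfl

theorem add_carry_ediv (z : S.Path) (k : ℤ) (n : ℕ) (j : ℤ) :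
    (z.digit n + (j + z.carry k n)) / S.N n =
      ((act k z).digit n + j) / S.N n + z.carry k (n + 1) := by
  have h := Int.emod_add_mul_ediv (z.digit n + z.carry k n) (S.N n)
  rw [show z.digit n + (j + z.carry k n) = ((act k z).digit n + j) +
    z.carry k (n + 1) * S.N n by rw [digit_act, carry]; linarith,
    Int.add_mul_ediv_right _ _ (S.N_pos n).ne']

theorem add_carry_emod (z : S.Path) (k : ℤ) (n : ℕ) (j : ℤ) :
    (z.digit n + (j + z.carry k n)) % S.N n = ((act k z).digit n + j) % S.N n := by
  have h := Int.emod_add_mul_ediv (z.digit n + z.carry k n) (S.N n)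
  rw [show z.digit n + (j + z.carry k n) = ((act k z).digit n + j) +
    z.carry k (n + 1) * S.N n by rw [digit_act, carry]; linarith, Int.add_mul_emod_self_right]

theorem letters_act (k : ℤ) (z : S.Path) (n : ℕ) (j : ℤ) :
    (act k z).letters n j = z.letters n (j + z.carry k n) := by
  refine letters_unique (G := (act k z).letters) (H := fun n j => z.letters n (j + z.carry k n))
    (act k z).digit_nonneg (act k z).digit_lt (act k z).letters_eq (fun n j => ?_) (fun n => ?_) n j
  · rw [letters_eq, add_carry_ediv, add_carry_emod]
  · rw [letters_zero, vert_act]; simp only [zero_add]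

/-- Recognizability for one stage. -/
theorem letters_succ_of_letters {z w : S.Path} {n : ℕ} {k : ℤ}
    (h : ∀ j, w.letters n j = z.letters n (j + k)) :
    w.digit n = (z.digit n + k) % S.N n ∧
      ∀ j, w.letters (n + 1) j = z.letters (n + 1) (j + (z.digit n + k) / S.N n) := by
  have hN := S.N_pos n
  have hw : w.digit n = (z.digit n + k) % S.N n := by
    have h1 := (w.mark_iff n (- w.digit n)).2 (by simp)
    rw [h, h, show -w.digit n + 1 + k = -w.digit n + k + 1 by ring, mark_iff] at h1
    have h2 : (z.digit n + k - w.digit n) % S.N n = 0 := by rw [← h1]; congr 1; ring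
    rw [← Int.emod_eq_of_lt (w.digit_nonneg n) (w.digit_lt n)]
    exact (Int.emod_eq_emod_iff_emod_sub_eq_zero.2 h2).symm
  refine ⟨hw, fun j => S.inj n _ _ fun s h0 h1 => ?_⟩
  rw [← letters_block _ _ _ _ h0 h1, ← letters_block _ _ _ _ h0 h1, h]
  congr 1
  have h := Int.emod_add_mul_ediv (z.digit n + k) (S.N n)
  rw [hw]
  linarith

theorem eq_act_of_letters {z w : S.Path} {k : ℤ}
    (h : ∀ j, w.letters 0 j = z.letters 0 (j + k)) : w = act k z := by
  have key : ∀ n j, w.letters n j = z.letters n (j + z.carry k n) := by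
    intro n
    induction n with
    | zero => exact h
    | succ n ih => exact (letters_succ_of_letters ih).2
  refine ext' (fun n => ?_) (fun n => ?_)
  · rw [vert_act, ← letters_zero, key, zero_add]
  · rw [digit_act, (letters_succ_of_letters (key n)).1]

theorem act_zero (z : S.Path) : act 0 z = z :=
  (eq_act_of_letters fun j => by rw [add_zero]).symm

theorem act_act (k l : ℤ) (z : S.Path) : act l (act k z) = act (k + l) z :=
  eq_act_of_letters fun j => by
    rw [letters_act, letters_act]; simp only [carry]; congr 1; ring

theorem act_neg_act (k : ℤ) (z : S.Path) : act (-k) (act k z) = z := by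
  rw [act_act, add_neg_cancel, act_zero]

theorem act_act_neg (k : ℤ) (z : S.Path) : act k (act (-k) z) = z := by
  rw [act_act, neg_add_cancel, act_zero]

end Path

end ToeplitzSystem

namespace ToeplitzSystem
variable {S : ToeplitzSystem}

/-! ### Orbits and tail equivalence -/

variable (S) in
/-- The path running through the first letters. -/
def minPath : S.Path :=
  ⟨fun n => (S.firstLetter n, 0), fun n => ⟨le_rfl, S.N_pos n, (S.first n _).symm⟩⟩

variable (S) in
/-- The path running through the last letters. -/
def maxPath : S.Path :=
  ⟨fun n => (S.lastLetter n, S.N n - 1), fun n =>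
    ⟨by have := S.two_le n; simp only; omega, by simp, (S.last n _).symm⟩⟩

namespace Path

/-- Two paths are tail equivalent if they agree from some stage on. -/
def TailEq (z w : S.Path) : Prop :=
  ∃ m, ∀ n, m ≤ n → z.vert n = w.vert n ∧ z.digit n = w.digit n

theorem approx_congr {z w : S.Path} (k n : ℕ) (j : ℤ) (h : z.vert (n + k) = w.vert (n + k))
    (h' : ∀ i, n ≤ i → i < n + k → z.digit i = w.digit i) : z.approx k n j = w.approx k n j := by
  induction k generalizing n j with
  | zero => exact h
  | succ k ih =>
    rw [approx_step, approx_step, h' n le_rfl (by omega),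
      ih (n + 1) _ (by rw [show n + 1 + k = n + (k + 1) by omega]; exact h)
        fun i hi hi' => h' i (by omega) (by omega)]

theorem letters_succ_imp {z w : S.Path} {n : ℕ} {k : ℤ}
    (h : ∀ j, w.letters (n + 1) j = z.letters (n + 1) (j + k)) (j : ℤ) :
    w.letters n j = z.letters n (j + (k * S.N n + w.digit n - z.digit n)) := by
  rw [letters_eq, letters_eq z, show z.digit n + (j + (k * S.N n + w.digit n - z.digit n)) =
    w.digit n + j + k * S.N n by ring, Int.add_mul_ediv_right _ _ (S.N_pos n).ne',
    Int.add_mul_emod_self_right, h]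

theorem TailEq.exists_act {z w : S.Path} (h : TailEq z w) : ∃ k, w = act k z := by
  obtain ⟨m, hm⟩ := h
  have key : ∀ n, n ≤ m → ∃ k, ∀ j, w.letters (m - n) j = z.letters (m - n) (j + k) := by
    intro n hn
    induction n with
    | zero =>
      refine ⟨0, fun j => ?_⟩
      rw [add_zero, letters, letters]
      exact approx_congr _ _ _ (hm _ (by omega)).1.symm fun i hi _ => (hm i (by omega)).2.symm
    | succ n ih =>
      obtain ⟨k, hk⟩ := ih (by omega)
      rw [show m - n = m - (n + 1) + 1 by omega] at hk
      exact ⟨_, letters_succ_imp hk⟩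
  obtain ⟨k, hk⟩ := key m le_rfl
  rw [Nat.sub_self] at hk
  exact ⟨k, eq_act_of_letters hk⟩

theorem tailEq_act_of_carry {z : S.Path} {k : ℤ} {m : ℕ} (h : z.carry k m = 0) :
    TailEq z (act k z) := by
  have h0 : ∀ n, m ≤ n → z.carry k n = 0 := by
    intro n hn
    induction n, hn using Nat.le_induction with
    | base => exact h
    | succ n _ ih =>
      rw [carry, ih, add_zero, Int.ediv_eq_zero_of_lt (z.digit_nonneg n) (z.digit_lt n)]
  refine ⟨m, fun n hn => ⟨?_, ?_⟩⟩
  · rw [vert_act, h0 n hn, letters_zero]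
  · rw [digit_act, h0 n hn, add_zero, Int.emod_eq_of_lt (z.digit_nonneg n) (z.digit_lt n)]

theorem tailEq_minPath {z : S.Path} {m : ℕ} (h : ∀ n, m ≤ n → z.digit n = 0) :
    TailEq z S.minPath :=
  ⟨m, fun n hn => ⟨by rw [vert_eq, h n hn, S.first]; rfl, h n hn⟩⟩

theorem tailEq_maxPath {z : S.Path} {m : ℕ} (h : ∀ n, m ≤ n → z.digit n = S.N n - 1) :
    TailEq z S.maxPath :=
  ⟨m, fun n hn => ⟨by rw [vert_eq, h n hn, S.last]; rfl, h n hn⟩⟩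

theorem natAbs_carry_succ_le (z : S.Path) (k : ℤ) (n : ℕ) :
    (z.carry k (n + 1)).natAbs ≤ max 1 ((z.carry k n).natAbs - 1) := by
  rw [carry]
  have hd := Int.emod_add_mul_ediv (z.digit n + z.carry k n) (S.N n)
  have hr0 := Int.emod_nonneg (z.digit n + z.carry k n) (S.N_pos n).ne'
  have hr1 := Int.emod_lt_of_pos (z.digit n + z.carry k n) (S.N_pos n)
  have h0 := z.digit_nonneg n
  have h1 := z.digit_lt n
  have h2 := S.two_le n
  generalize (z.digit n + z.carry k n) / S.N n = x at *
  generalize (z.digit n + z.carry k n) % S.N n = r at *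
  generalize z.carry k n = y at *
  generalize z.digit n = t at *
  generalize S.N n = N at *
  by_contra! hcon
  rcases le_or_gt 0 x with hx | hx
  · have h1 : (x - 2) * (N - 2) ≥ 0 := mul_nonneg (by omega) (by omega)
    have h3 : (x - 2) * (N - 2) = N * x - 2 * x - 2 * N + 4 := by ring
    have h4 : y ≤ x := by omega
    omega
  · have h1 : (-x - 2) * (N - 2) ≥ 0 := mul_nonneg (by omega) (by omega)
    have h3 : (-x - 2) * (N - 2) = -(N * x) + 2 * x - 2 * N + 4 := by ring
    have h4 : x ≤ y := by omega
    omega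

theorem exists_natAbs_carry_le (z : S.Path) (k : ℤ) : ∃ m, (z.carry k m).natAbs ≤ 1 := by
  by_contra! hcon
  have : ∀ n, (z.carry k n).natAbs + n ≤ k.natAbs := by
    intro n
    induction n with
    | zero => simp [carry]
    | succ n ih =>
      have h1 := z.natAbs_carry_succ_le k n
      have h2 := hcon (n + 1)
      omega
  have h1 := this (k.natAbs + 1)
  omega

/-- The orbits of the action are the tail classes, except that the tail classes of the minimal and
the maximal path form one orbit. -/
theorem exists_act_iff (z w : S.Path) : (∃ k, w = act k z) ↔
    TailEq z w ∨ (TailEq z S.maxPath ∧ TailEq w S.minPath) ∨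
      (TailEq z S.minPath ∧ TailEq w S.maxPath) := by
  constructor
  · rintro ⟨k, rfl⟩
    obtain ⟨m, hm⟩ := z.exists_natAbs_carry_le k
    by_cases h0 : ∃ n, z.carry k n = 0
    · exact Or.inl (tailEq_act_of_carry h0.choose_spec)
    push Not at h0
    right
    have hcarry : ∀ n, z.carry k (n + 1) = (z.digit n + z.carry k n) / S.N n := fun n => rfl
    have aux : ∀ n, (z.carry k n = 1 → z.carry k (n + 1) = 1 ∧ z.digit n = S.N n - 1 ∧
        (act k z).digit n = 0) ∧ (z.carry k n = -1 → z.carry k (n + 1) = -1 ∧ z.digit n = 0 ∧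
        (act k z).digit n = S.N n - 1) := by
      intro n
      have h2 := h0 (n + 1)
      have h3 := z.digit_nonneg n
      have h4 := z.digit_lt n
      have h5 := S.two_le n
      constructor
      · intro h
        rw [hcarry, h] at h2
        rw [digit_act, hcarry, h]
        have h6 : z.digit n = S.N n - 1 := by
          by_contra h7
          exact h2 (Int.ediv_eq_zero_of_lt (by omega) (by omega))
        rw [h6, sub_add_cancel, Int.emod_self, Int.ediv_self (by omega)]
        simp
      · intro h
        rw [hcarry, h] at h2
        rw [digit_act, hcarry, h]
        have h6 : z.digit n = 0 := by
          by_contra h7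
          exact h2 (Int.ediv_eq_zero_of_lt (by omega) (by omega))
        rw [h6, zero_add, ← Int.add_emod_right, Int.emod_eq_of_lt (by omega) (by omega)]
        refine ⟨?_, rfl, by ring⟩
        rw [Int.ediv_eq_iff_of_pos (by omega)]
        omega
    have hm0 := h0 m
    have : z.carry k m = 1 ∨ z.carry k m = -1 := by omega
    rcases this with h | h
    · have key : ∀ n, m ≤ n → z.carry k n = 1 := by
        intro n hn
        induction n, hn using Nat.le_induction with
        | base => exact h
        | succ n _ ih => exact ((aux n).1 ih).1
      exact Or.inl ⟨tailEq_maxPath fun n hn => ((aux n).1 (key n hn)).2.1,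
        tailEq_minPath fun n hn => ((aux n).1 (key n hn)).2.2⟩
    · have key : ∀ n, m ≤ n → z.carry k n = -1 := by
        intro n hn
        induction n, hn using Nat.le_induction with
        | base => exact h
        | succ n _ ih => exact ((aux n).2 ih).1
      exact Or.inr ⟨tailEq_minPath fun n hn => ((aux n).2 (key n hn)).2.1,
        tailEq_maxPath fun n hn => ((aux n).2 (key n hn)).2.2⟩
  · have hmm : act 1 S.maxPath = S.minPath := by
      have hc : ∀ n, (S.maxPath).carry 1 n = 1 := by
        intro n
        induction n with
        | zero => rfl
        | succ n ih =>
          rw [carry, ih]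
          change (S.N n - 1 + 1) / S.N n = 1
          rw [sub_add_cancel, Int.ediv_self (S.N_pos n).ne']
      have hd : ∀ n, (act 1 S.maxPath).digit n = 0 := by
        intro n
        rw [digit_act, hc]
        change (S.N n - 1 + 1) % S.N n = 0
        rw [sub_add_cancel, Int.emod_self]
      refine ext' (fun n => ?_) hd
      rw [vert_eq, hd, S.first]
      rfl
    have symm : ∀ {z w : S.Path}, TailEq z w → TailEq w z := fun ⟨m, h⟩ =>
      ⟨m, fun n hn => ⟨(h n hn).1.symm, (h n hn).2.symm⟩⟩
    rintro (h | ⟨h1, h2⟩ | ⟨h1, h2⟩)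
    · exact h.exists_act
    · obtain ⟨k, hk⟩ := h1.exists_act
      obtain ⟨l, hl⟩ := (symm h2).exists_act
      exact ⟨k + 1 + l, by rw [hl, ← hmm, hk, act_act, act_act]; congr 1; ring⟩
    · obtain ⟨k, hk⟩ := h1.exists_act
      obtain ⟨l, hl⟩ := (symm h2).exists_act
      refine ⟨k + -1 + l, ?_⟩
      rw [hl, ← act_act, ← act_act, ← hk, ← hmm, act_neg_act]

/-! ### Topology of the path space -/

theorem continuous_vert (n : ℕ) : Continuous fun z : S.Path => z.vert n :=
  continuous_fst.comp ((continuous_apply n).comp continuous_subtype_val)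

theorem continuous_digit (n : ℕ) : Continuous fun z : S.Path => z.digit n :=
  continuous_snd.comp ((continuous_apply n).comp continuous_subtype_val)

instance : T2Space S.Path := inferInstanceAs (T2Space (Subtype _))

instance : CompactSpace S.Path := by
  have hK : IsCompact (Set.univ.pi fun n => (Set.univ : Set (Vertex n)) ×ˢ Set.Icc 0 (S.N n)) :=
    isCompact_univ_pi fun n => isCompact_univ.prod isCompact_Icc
  have hC : IsClosed (⋂ n, {z : (n : ℕ) → Vertex n × ℤ | 0 ≤ (z n).2 ∧ (z n).2 < S.N n ∧
      (z n).1 = S.Θ n (z (n + 1)).1 (z n).2}) := by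
    refine isClosed_iInter fun n => ?_
    have hc : Continuous fun z : (n : ℕ) → Vertex n × ℤ => (z n, z (n + 1)) := by fun_prop
    exact (isClosed_discrete {p : (Vertex n × ℤ) × (Vertex (n + 1) × ℤ) |
      0 ≤ p.1.2 ∧ p.1.2 < S.N n ∧ p.1.1 = S.Θ n p.2.1 p.1.2}).preimage hc
  have := hK.of_isClosed_subset hC fun z hz n _ => by
    have := Set.mem_iInter.1 hz n
    exact ⟨trivial, this.1, this.2.1.le⟩
  have h2 : IsCompact {z : (n : ℕ) → Vertex n × ℤ | ∀ n, 0 ≤ (z n).2 ∧ (z n).2 < S.N n ∧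
      (z n).1 = S.Θ n (z (n + 1)).1 (z n).2} := by
    convert this using 1
    ext
    simp
  exact isCompact_iff_compactSpace.1 h2

theorem eventually_eq_digit (z : S.Path) (n : ℕ) :
    ∀ᶠ w in 𝓝 z, w.digit n = z.digit n :=
  (continuous_digit n).continuousAt.preimage_mem_nhds
    ((isOpen_discrete {z.digit n}).mem_nhds rfl)

theorem eventually_eq_vert (z : S.Path) (n : ℕ) :
    ∀ᶠ w in 𝓝 z, w.vert n = z.vert n :=
  (continuous_vert n).continuousAt.preimage_mem_nhds
    ((isOpen_discrete {z.vert n}).mem_nhds rfl)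

theorem eventually_eq_letters (z : S.Path) (n : ℕ) (j : ℤ) :
    ∀ᶠ w in 𝓝 z, w.letters n j = z.letters n j := by
  have h := (Filter.eventually_all_finset (l := 𝓝 z) (Finset.range (n + j.natAbs))
    (p := fun i w => w.digit i = z.digit i)).2 fun i _ => z.eventually_eq_digit i
  filter_upwards [h, z.eventually_eq_vert (n + j.natAbs)] with w hw hw'
  exact approx_congr _ _ _ hw' fun i _ hi => hw i (Finset.mem_range.2 hi)

/-- The symbolic coding of a path. -/
def code (z : S.Path) : Cantor := fun j => z.letters 0 j 0

theorem continuous_code : Continuous (code : S.Path → Cantor) := by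
  refine continuous_pi fun j => ?_
  refine continuous_iff_continuousAt.2 fun z => ?_
  refine tendsto_nhds_of_eventually_eq ?_
  filter_upwards [z.eventually_eq_letters 0 j] with w hw
  rw [code, code, hw]

theorem letters_eq_of_code {z w : S.Path} {j k : ℤ} (h : z.code j = w.code k) :
    z.letters 0 j = w.letters 0 k := by
  funext i
  obtain rfl : i = 0 := Fin.fin_one_eq_zero i
  exact h

theorem eq_act_iff_code {z w : S.Path} {k : ℤ} :
    w = act k z ↔ ∀ j, w.code j = z.code (j + k) := by
  constructor
  · rintro rfl j
    rw [code, letters_act]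
    rfl
  · exact fun h => eq_act_of_letters fun j => letters_eq_of_code (h j)

theorem isEmbedding_code : IsEmbedding (code : S.Path → Cantor) := by
  refine (continuous_code.isClosedEmbedding fun z w h => ?_).isEmbedding
  rw [← act_zero w, eq_act_iff_code]
  intro j
  rw [h, add_zero]

theorem continuous_act (k : ℤ) : Continuous (act k : S.Path → S.Path) := by
  rw [isEmbedding_code.continuous_iff]
  refine continuous_pi fun j => ?_
  have : (fun z : S.Path => (code ∘ act k) z j) = fun z => z.code (j + k) :=
    funext fun z => eq_act_iff_code.1 rfl j
  rw [this]
  exact (continuous_apply (A := fun _ => Bool) (j + k)).comp continuous_code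

end Path

theorem iterate_shift {A : Type*} (n : ℕ) (x : ℤ → A) (j : ℤ) : shift^[n] x j = x (j + n) := by
  induction n generalizing x with
  | zero => simp
  | succ n ih =>
    rw [Function.iterate_succ_apply, ih, shift]
    push_cast
    congr 1
    ring

theorem mem_zOrbit_shift_iff {A : Type*} (x y : ℤ → A) :
    y ∈ zOrbit shift x ↔ ∃ k : ℤ, ∀ j, y j = x (j + k) := by
  constructor
  · rintro ⟨n, rfl | rfl⟩
    · exact ⟨n, iterate_shift n x⟩
    · exact ⟨-n, fun j => by rw [iterate_shift, neg_add_cancel_right]⟩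
  · rintro ⟨k, hk⟩
    refine ⟨k.natAbs, ?_⟩
    rcases le_total 0 k with h | h
    · left
      funext j
      rw [iterate_shift, hk]
      congr 2
      omega
    · right
      funext j
      rw [iterate_shift, hk]
      congr 1
      omega

namespace Path

theorem code_mem_zOrbit_iff (z w : S.Path) :
    w.code ∈ zOrbit shift z.code ↔ ∃ k, w = act k z := by
  simp only [mem_zOrbit_shift_iff, eq_act_iff_code]

end Path

/-- The return time bound of the orbit of the minimal path. -/
def returnBound (N : ℕ → ℤ) : ℕ → ℕ → ℤ
  | 0, m => N m
  | n + 1, m => (returnBound N n (m + 1) + 1) * N m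

namespace Path

theorem exists_return (z : S.Path) (n m : ℕ) : ∃ k : ℤ, |k| ≤ returnBound S.N n m ∧
    ∀ j : ℤ, j.natAbs ≤ n → S.minPath.letters m (j + k) = z.letters m j := by
  induction n generalizing m with
  | zero =>
    obtain ⟨t, h0, h1, ht⟩ := S.occ m (S.minPath.letters (m + 1) 0) (z.vert m)
    refine ⟨t, by rw [abs_of_nonneg h0]; exact h1.le, fun j hj => ?_⟩
    obtain rfl : j = 0 := by omega
    have := S.minPath.letters_block m 0 t h0 h1
    rw [show 0 * S.N m + t - S.minPath.digit m = 0 + t by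
      change _ + _ - 0 = _; ring] at this
    rw [this, ht, letters_zero]
  | succ n ih =>
    obtain ⟨k, hk, hk'⟩ := ih (m + 1)
    have h0 := z.digit_nonneg m
    have h1 := z.digit_lt m
    have hN := S.N_pos m
    refine ⟨z.digit m + k * S.N m, ?_, fun j hj => ?_⟩
    · rw [returnBound, abs_le] at *
      constructor <;> nlinarith
    · rw [letters_eq, letters_eq z, show S.minPath.digit m = 0 from rfl,
        show 0 + (j + (z.digit m + k * S.N m)) = (z.digit m + j) + k * S.N m by ring,
        Int.add_mul_ediv_right _ _ hN.ne', Int.add_mul_emod_self_right]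
      rcases carry_cases h0 h1 (S.two_le m) hj with h | h
      · rw [hk' _ h]
      · exact Θ_congr_of_edge m h _ _

end Path

variable (S) in
/-- The subshift of a system. -/
def subshift : NonemptyCompacts Cantor :=
  ⟨⟨Set.range (Path.code : S.Path → Cantor), isCompact_range Path.continuous_code⟩,
    ⟨_, S.minPath, rfl⟩⟩

theorem coe_subshift : (S.subshift : Set Cantor) = Set.range (Path.code : S.Path → Cantor) := rfl

theorem mem_nhds_iff_window {x : Cantor} {U : Set Cantor} :
    U ∈ 𝓝 x ↔ ∃ n : ℕ, ∀ y : Cantor, (∀ j : ℤ, j.natAbs ≤ n → y j = x j) → y ∈ U := by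
  constructor
  · intro h
    rw [nhds_pi, Filter.mem_pi'] at h
    obtain ⟨I, t, ht, hU⟩ := h
    refine ⟨I.sup Int.natAbs, fun y hy => hU fun j hj => ?_⟩
    rw [hy j (Finset.le_sup hj)]
    exact mem_of_mem_nhds (ht j)
  · rintro ⟨n, hn⟩
    have : ∀ᶠ y : Cantor in 𝓝 x, ∀ j ∈ Finset.Icc (-n : ℤ) n, y j = x j :=
      (Filter.eventually_all_finset _).2 fun j _ =>
        (continuous_apply (A := fun _ => Bool) j).continuousAt.preimage_mem_nhds
          ((isOpen_discrete {x j}).mem_nhds rfl)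
    filter_upwards [this] with y hy
    exact hn y fun j hj => hy j (by rw [Finset.mem_Icc]; omega)

theorem subshift_eq_closure : (S.subshift : Set Cantor) =
    closure (zOrbit shift S.minPath.code) := by
  rw [coe_subshift]
  apply subset_antisymm
  · rintro _ ⟨z, rfl⟩
    rw [mem_closure_iff_nhds]
    intro U hU
    obtain ⟨n, hn⟩ := mem_nhds_iff_window.1 hU
    obtain ⟨k, -, hk⟩ := z.exists_return n 0
    refine ⟨(Path.act k S.minPath).code, hn _ fun j hj => ?_, ?_⟩
    · rw [Path.eq_act_iff_code.1 rfl j, Path.code, hk j hj, Path.code]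
    · exact (Path.code_mem_zOrbit_iff _ _).2 ⟨k, rfl⟩
  · refine closure_minimal ?_ (isCompact_range Path.continuous_code).isClosed
    intro y hy
    obtain ⟨k, hk⟩ := (mem_zOrbit_shift_iff _ _).1 hy
    exact ⟨Path.act k S.minPath, funext fun j => by rw [hk, Path.eq_act_iff_code.1 rfl j]⟩

end ToeplitzSystem

namespace ToeplitzSystem
variable {S : ToeplitzSystem}

/-! ### Regularity -/

variable (S) in
/-- The length of the words of level `0` letters coded by the vertices at stage `n`. -/
def height : ℕ → ℤ
  | 0 => 1
  | n + 1 => height n * S.N n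

theorem height_pos (S : ToeplitzSystem) (n : ℕ) : 0 < S.height n := by
  induction n with
  | zero => exact one_pos
  | succ n ih => exact mul_pos ih (S.N_pos n)

theorem lt_height (S : ToeplitzSystem) (n : ℕ) : (n : ℤ) < S.height n := by
  induction n with
  | zero => exact one_pos
  | succ n ih =>
    have := S.two_le n
    rw [height]
    push_cast
    nlinarith

variable (S) in
/-- The level `0` word of a vertex at stage `n`. -/
def word : (n : ℕ) → Vertex n → ℤ → Vertex 0
  | 0, V, _ => V
  | n + 1, V, r => word n (S.Θ n V (r / S.height n)) (r % S.height n)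

theorem emod_mul_ediv_eq {h N : ℤ} (hh : 0 < h) (x : ℤ) :
    x % (h * N) / h = x / h % N := by
  rw [Int.emod_def, Int.emod_def, Int.ediv_ediv_of_nonneg hh.le,
    show x - h * N * (x / (h * N)) = x + h * (-(N * (x / (h * N)))) by ring,
    Int.add_mul_ediv_left _ _ hh.ne']
  ring

namespace Path

/-- The position of a path inside the level `0` word of its vertex at stage `n`. -/
def pos (z : S.Path) : ℕ → ℤ
  | 0 => 0
  | n + 1 => z.pos n + z.digit n * S.height n

theorem letters_eq_word (z : S.Path) (n : ℕ) (j : ℤ) : z.letters 0 j =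
    S.word n (z.letters n ((z.pos n + j) / S.height n)) ((z.pos n + j) % S.height n) := by
  induction n with
  | zero => simp [pos, height, word]
  | succ n ih =>
    have h1 : (z.pos (n + 1) + j) / S.height n = z.digit n + (z.pos n + j) / S.height n := by
      rw [pos, show z.pos n + z.digit n * S.height n + j = z.pos n + j + z.digit n * S.height n
        by ring, Int.add_mul_ediv_right _ _ (S.height_pos n).ne', add_comm]
    have h2 : (z.pos (n + 1) + j) % S.height n = (z.pos n + j) % S.height n := by
      rw [pos, show z.pos n + z.digit n * S.height n + j = z.pos n + j + z.digit n * S.height n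
        by ring, Int.add_mul_emod_self_right]
    rw [word, height, emod_mul_ediv_eq (S.height_pos n),
      Int.emod_emod_of_dvd _ (dvd_mul_right _ _), h1, h2, ih, letters_eq,
      ← Int.ediv_ediv_of_nonneg (S.height_pos n).le, h1]

theorem pos_minPath (n : ℕ) : S.minPath.pos n = 0 := by
  induction n with
  | zero => rfl
  | succ n ih => rw [pos, ih, show S.minPath.digit n = 0 from rfl, zero_mul, add_zero]

end Path

theorem code_minPath_periodic {n : ℕ} {j : ℤ}
    (h : ∀ V V', S.word n V (j % S.height n) = S.word n V' (j % S.height n)) (k : ℤ) :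
    S.minPath.code (j + k * S.height n) = S.minPath.code j := by
  rw [Path.code, Path.code, Path.letters_eq_word _ n, Path.letters_eq_word _ n, Path.pos_minPath]
  simp only [zero_add]
  rw [Int.add_mul_emod_self_right, h]

theorem word_const (S : ToeplitzSystem) (n : ℕ) {j : ℤ} (hj : j.natAbs ≤ n) :
    ∀ V V', S.word (n + 1) V (j % S.height (n + 1)) = S.word (n + 1) V' (j % S.height (n + 1)) := by
  intro V V'
  have hn := S.lt_height n
  have h2 := S.two_le n
  rw [word, word, height, emod_mul_ediv_eq (S.height_pos n)]
  congr 1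
  apply Θ_congr_of_edge
  rcases le_or_gt 0 j with h | h
  · left
    rw [Int.ediv_eq_zero_of_lt h (by omega), Int.zero_emod]
  · right
    have : j / S.height n = -1 := by
      rw [Int.ediv_eq_iff_of_pos (by omega)]
      omega
    rw [this, ← Int.add_emod_right, Int.emod_eq_of_lt (by omega) (by omega)]
    ring

theorem finite_Ico_sep (N : ℤ) (p : ℤ → Prop) : {t : ℤ | 0 ≤ t ∧ t < N ∧ p t}.Finite :=
  (Set.finite_Ico 0 N).subset fun _ h => ⟨h.1, h.2.1⟩

theorem ncard_word_le (S : ToeplitzSystem) (n : ℕ) :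
    2 ^ n * {r : ℤ | 0 ≤ r ∧ r < S.height n ∧ ¬ ∀ V V', S.word n V r = S.word n V' r}.ncard ≤
      S.height n := by
  induction n with
  | zero =>
    have : {r : ℤ | 0 ≤ r ∧ r < S.height 0 ∧ ¬ ∀ V V', S.word 0 V r = S.word 0 V' r} ⊆ {0} := by
      rintro r ⟨h0, h1, -⟩
      rw [height] at h1
      exact Set.mem_singleton_iff.2 (by omega)
    have := Set.ncard_le_ncard this
    rw [Set.ncard_singleton] at this
    rw [pow_zero, one_mul]
    change _ ≤ (1 : ℤ)
    exact_mod_cast this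
  | succ n ih =>
    have hh := S.height_pos n
    have key : {r : ℤ | 0 ≤ r ∧ r < S.height (n + 1) ∧
        ¬ ∀ V V', S.word (n + 1) V r = S.word (n + 1) V' r}.ncard ≤
        ({t : ℤ | 0 ≤ t ∧ t < S.N n ∧ ¬ ∀ V V', S.Θ n V t = S.Θ n V' t} ×ˢ
          {r : ℤ | 0 ≤ r ∧ r < S.height n ∧
            ¬ ∀ V V', S.word n V r = S.word n V' r}).ncard := by
      refine Set.ncard_le_ncard_of_injOn (fun r => (r / S.height n, r % S.height n)) ?_ ?_
        ((finite_Ico_sep _ _).prod (finite_Ico_sep _ _))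
      · rintro r ⟨h0, h1, h2⟩
        refine ⟨⟨Int.ediv_nonneg h0 hh.le, Int.ediv_lt_of_lt_mul hh ?_, fun h => h2 ?_⟩,
          Int.emod_nonneg _ hh.ne', Int.emod_lt_of_pos _ hh, fun h => h2 ?_⟩
        · rw [mul_comm]; exact h1
        · intro V V'
          rw [word, word, h V V']
        · intro V V'
          rw [word, word, h]
      · intro r _ s _ h
        rw [← Int.emod_add_mul_ediv r (S.height n), ← Int.emod_add_mul_ediv s (S.height n)]
        have h1 := congrArg Prod.fst h
        have h2 := congrArg Prod.snd h
        simp only at h1 h2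
        rw [h1, h2]
    rw [Set.ncard_prod] at key
    have hr := S.reg n
    rw [height]
    zify at key
    calc _ ≤ (2 : ℤ) ^ (n + 1) * _ := mul_le_mul_of_nonneg_left key (by positivity)
      _ = (2 ^ n * _) * (2 * _) := by ring
      _ ≤ _ := mul_le_mul ih hr (by positivity) hh.le

theorem toeplitzDelta_le_one {A : Type*} (x : ℤ → A) {p : ℕ} : toeplitzDelta x p ≤ 1 := by
  refine div_le_one_of_le₀ ?_ (by positivity)
  have : {k : ℤ | 0 ≤ k ∧ k < (p : ℤ) ∧ ∀ n : ℤ, x (k + n * p) = x k}.ncard ≤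
      (Set.Ico 0 (p : ℤ)).ncard :=
    Set.ncard_le_ncard (fun _ h => ⟨h.1, h.2.1⟩) (Set.finite_Ico _ _)
  rw [← Finset.coe_Ico, Set.ncard_coe_finset, Int.card_Ico] at this
  exact_mod_cast (by simpa using this)

theorem isRegularToeplitzSubshift (S : ToeplitzSystem) :
    IsRegularToeplitzSubshift (S.subshift : Set Cantor) := by
  have hcast : ∀ n, ((S.height n).toNat : ℤ) = S.height n := fun n =>
    Int.toNat_of_nonneg (S.height_pos n).le
  have hp : ∀ n, 1 ≤ (S.height n).toNat := fun n => by
    have := S.height_pos n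
    omega
  refine ⟨S.minPath.code, ⟨fun j => ⟨(S.height (j.natAbs + 1)).toNat, hp _, fun n => ?_⟩, ?_⟩,
    S.subshift_eq_closure⟩
  · rw [hcast]
    exact code_minPath_periodic (S.word_const _ le_rfl) n
  · refine IsLUB.csSup_eq ⟨?_, fun b hb => ?_⟩ ⟨_, _, hp 0, rfl⟩
    · rintro _ ⟨p, -, rfl⟩
      exact toeplitzDelta_le_one _
    · have key : ∀ n : ℕ, 1 - (1 / 2 : ℝ) ^ n ≤ b := by
        intro n
        refine le_trans ?_ (hb ⟨(S.height n).toNat, hp n, rfl⟩)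
        have h1 := S.ncard_word_le n
        have hpos := S.height_pos n
        set K := {r : ℤ | 0 ≤ r ∧ r < S.height n ∧ ¬ ∀ V V', S.word n V r = S.word n V' r}
          with hK
        have h2 : (Set.Ico 0 (S.height n)).ncard ≤ {k : ℤ | 0 ≤ k ∧ k < ((S.height n).toNat : ℤ) ∧
            ∀ i : ℤ, S.minPath.code (k + i * (S.height n).toNat) = S.minPath.code k}.ncard +
            K.ncard := by
          refine (Set.ncard_le_ncard ?_ ((finite_Ico_sep _ _).union (finite_Ico_sep _ _))).trans
            (Set.ncard_union_le _ _)
          rintro k ⟨h0, h1⟩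
          by_cases hk : ∀ V V', S.word n V k = S.word n V' k
          · left
            rw [Set.mem_ofPred_eq, hcast]
            refine ⟨h0, h1, code_minPath_periodic ?_⟩
            rwa [Int.emod_eq_of_lt h0 h1]
          · exact Or.inr ⟨h0, h1, hk⟩
        rw [← Finset.coe_Ico, Set.ncard_coe_finset, Int.card_Ico, sub_zero] at h2
        have h3 : ((S.height n).toNat : ℝ) = S.height n := by exact_mod_cast hcast n
        have h4 : (0 : ℝ) < S.height n := by exact_mod_cast hpos
        have h5 : (2 : ℝ) ^ n * K.ncard ≤ S.height n := by exact_mod_cast h1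
        rw [toeplitzDelta, h3, le_div_iff₀ h4]
        have h6 := (Nat.cast_le (α := ℝ)).2 h2
        rw [Nat.cast_add, h3] at h6
        have h7 : (K.ncard : ℝ) ≤ (1 / 2) ^ n * S.height n := by
          rw [one_div, inv_pow, inv_mul_eq_div, le_div_iff₀ (by positivity)]
          linarith
        linarith
      have hlim : Filter.Tendsto (fun n : ℕ => 1 - (1 / 2 : ℝ) ^ n) Filter.atTop (𝓝 (1 - 0)) :=
        (tendsto_pow_atTop_nhds_zero_of_lt_one (by norm_num) (by norm_num)).const_sub 1
      rw [sub_zero] at hlim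
      exact le_of_tendsto' hlim key

end ToeplitzSystem

/-- A continuous self-map of a compact metrizable space has an invariant probability measure. -/
theorem exists_invariant_measure {X : Type*} [TopologicalSpace X] [CompactSpace X] [T2Space X]
    [HasOuterApproxClosed X] [MeasurableSpace X] [BorelSpace X] [Nonempty X] {T : X → X}
    (hT : Continuous T) : ∃ μ : Measure X, IsProbabilityMeasure μ ∧ μ.map T = μ := by
  obtain ⟨x⟩ := ‹Nonempty X›
  let μ : ℕ → Measure X := fun n =>
    ((n : ENNReal) + 1)⁻¹ • ∑ k ∈ Finset.range (n + 1), Measure.dirac (T^[k] x)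
  have hμ : ∀ n, IsProbabilityMeasure (μ n) := fun n => ⟨by
    simp only [μ, Measure.smul_apply, Measure.finsetSum_apply, measure_univ, Finset.sum_const,
      Finset.card_range, smul_eq_mul, nsmul_eq_mul, mul_one]
    push_cast
    exact ENNReal.inv_mul_cancel (by simp) (by finiteness)⟩
  have hint : ∀ (f : BoundedContinuousFunction X ℝ) n,
      ∫ y, f y ∂(μ n) = ((n : ℝ) + 1)⁻¹ * ∑ k ∈ Finset.range (n + 1), f (T^[k] x) := by
    intro f n
    simp only [μ]
    rw [integral_smul_measure, integral_finsetSum_measure fun k _ => f.integrable _]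
    simp only [integral_dirac, smul_eq_mul]
    congr 1
    rw [ENNReal.toReal_inv, ENNReal.toReal_add (by finiteness) (by finiteness)]
    simp
  let P : ℕ → ProbabilityMeasure X := fun n => ⟨μ n, hμ n⟩
  let F : Ultrafilter ℕ := Filter.hyperfilter ℕ
  have hF : (F : Filter ℕ) ≤ Filter.atTop := by
    rw [← Nat.cofinite_eq_atTop]
    exact Filter.hyperfilter_le_cofinite
  obtain ⟨ν, -, hν⟩ := isCompact_univ.ultrafilter_le_nhds (F.map P) (by simp)
  have hν' : Filter.Tendsto P F (𝓝 ν) := hν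
  rw [ProbabilityMeasure.tendsto_iff_forall_integral_tendsto] at hν'
  refine ⟨ν, inferInstance, ?_⟩
  have : IsProbabilityMeasure ((ν : Measure X).map T) :=
    Measure.isProbabilityMeasure_map hT.measurable.aemeasurable
  refine ext_of_forall_integral_eq_of_IsFiniteMeasure fun f => ?_
  rw [integral_map hT.measurable.aemeasurable f.continuous.aestronglyMeasurable]
  let g : BoundedContinuousFunction X ℝ := f.compContinuous ⟨T, hT⟩
  have h1 := (hν' g).sub (hν' f)
  have h2 : Filter.Tendsto (fun n => ∫ y, g y ∂(P n : Measure X) - ∫ y, f y ∂(P n : Measure X))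
      F (𝓝 0) := by
    refine Filter.Tendsto.mono_left ?_ hF
    refine squeeze_zero_norm (a := fun n : ℕ => 2 * ‖f‖ * (1 / ((n : ℝ) + 1))) (fun n => ?_) ?_
    · have : ∫ y, g y ∂(P n : Measure X) - ∫ y, f y ∂(P n : Measure X) =
          ((n : ℝ) + 1)⁻¹ * (f (T^[n + 1] x) - f x) := by
        change ∫ y, g y ∂(μ n) - ∫ y, f y ∂(μ n) = _
        rw [hint, hint, ← mul_sub, ← Finset.sum_sub_distrib,
          show f (T^[n + 1] x) - f x = f (T^[n + 1] x) - f (T^[0] x) from rfl,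
          ← Finset.sum_range_sub (fun k => f (T^[k] x)) (n + 1)]
        congr 1
        refine Finset.sum_congr rfl fun k _ => ?_
        rw [Function.iterate_succ_apply']
        rfl
      rw [this, norm_mul, norm_inv, Real.norm_of_nonneg (by positivity), one_div, mul_comm]
      refine mul_le_mul_of_nonneg_right ?_ (by positivity)
      calc _ ≤ ‖f (T^[n + 1] x)‖ + ‖f x‖ := norm_sub_le _ _
        _ ≤ ‖f‖ + ‖f‖ := add_le_add (f.norm_coe_le_norm _) (f.norm_coe_le_norm _)
        _ = 2 * ‖f‖ := by ring
    · simpa using tendsto_one_div_add_atTop_nhds_zero_nat.const_mul (2 * ‖f‖)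
  have h3 := tendsto_nhds_unique h1 h2
  exact sub_eq_zero.1 h3

namespace ToeplitzSystem

variable {S : ToeplitzSystem}

instance : MeasurableSpace S.Path := borel _

instance : BorelSpace S.Path := ⟨rfl⟩

namespace Path

theorem map_act {μ : Measure S.Path} (h : μ.map (act 1) = μ) (k : ℤ) : μ.map (act k) = μ := by
  have hm : ∀ k, Measurable (act k : S.Path → S.Path) := fun k => (continuous_act k).measurable
  have hcomp : ∀ k l, μ.map (act (k + l)) = (μ.map (act k)).map (act l) := fun k l => by
    rw [Measure.map_map (hm l) (hm k)]
    exact congrArg (fun f => μ.map f) (funext fun z => (act_act k l z).symm)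
  have hid : μ.map (act 0) = μ := by
    rw [show (act 0 : S.Path → S.Path) = id from funext act_zero, Measure.map_id]
  induction k with
  | zero => exact hid
  | succ k ih => rw [hcomp, ih, h]
  | pred k ih =>
    have h1 := hcomp 1 (-k - 1)
    rw [h, show (1 : ℤ) + (-k - 1) = -k by ring, ih] at h1
    exact h1.symm

/-- An invariant measure is invariant under all homeomorphisms preserving every orbit. -/
theorem map_of_orbit {μ : Measure S.Path} (h : μ.map (act 1) = μ) (τ : S.Path ≃ₜ S.Path)
    (hτ : ∀ z, ∃ k, τ z = act k z) : μ.map τ = μ := by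
  have hm : ∀ k, Measurable (act k : S.Path → S.Path) := fun k => (continuous_act k).measurable
  ext B hB
  rw [Measure.map_apply τ.continuous.measurable hB]
  obtain ⟨e⟩ : Nonempty (ℕ ≃ ℤ) := inferInstance
  let E : ℕ → Set S.Path := fun n => {z | τ z = act (e n) z}
  have hE : ∀ n, MeasurableSet (E n) := fun n =>
    (isClosed_eq τ.continuous (continuous_act (e n))).measurableSet
  have hD : ∀ n, MeasurableSet (disjointed E n) := fun n => MeasurableSet.disjointed hE n
  have hU : ⋃ n, disjointed E n = Set.univ := by
    rw [iUnion_disjointed, Set.eq_univ_iff_forall]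
    intro z
    obtain ⟨k, hk⟩ := hτ z
    exact Set.mem_iUnion.2 ⟨e.symm k, by simp [E, hk]⟩
  have hd := disjoint_disjointed E
  have hsub : ∀ n, disjointed E n ⊆ E n := fun n => disjointed_subset E n
  have key : ∀ n, μ (disjointed E n ∩ τ ⁻¹' B) = μ (τ.symm ⁻¹' disjointed E n ∩ B) := by
    intro n
    have h1 := congrArg (fun m => m (disjointed E n ∩ τ ⁻¹' B)) (map_act h (-e n))
    rw [Measure.map_apply (hm _) ((hD n).inter (τ.continuous.measurable hB))] at h1
    rw [← h1]
    congr 1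
    ext w
    have aux : ∀ z ∈ disjointed E n, ∀ w, act (-e n) w = z ↔ τ.symm w = z := by
      intro z hz w
      have h2 : τ z = act (e n) z := hsub n hz
      rw [Homeomorph.symm_apply_eq, h2]
      constructor
      · rintro rfl
        rw [act_act_neg]
      · rintro rfl
        rw [act_neg_act]
    constructor
    · rintro ⟨h2, h3⟩
      have h4 := (aux _ h2 w).1 rfl
      refine ⟨?_, ?_⟩
      · rw [Set.mem_preimage, h4]; exact h2
      · rw [Set.mem_preimage, ← h4, Homeomorph.apply_symm_apply] at h3
        exact h3
    · rintro ⟨h2, h3⟩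
      have h4 := (aux _ h2 w).2 rfl
      rw [Set.mem_preimage, h4]
      exact ⟨h2, by rw [Set.mem_preimage, Homeomorph.apply_symm_apply]; exact h3⟩
  calc μ (τ ⁻¹' B) = μ (⋃ n, disjointed E n ∩ τ ⁻¹' B) := by
        rw [← Set.iUnion_inter, hU, Set.univ_inter]
    _ = ∑' n, μ (disjointed E n ∩ τ ⁻¹' B) :=
        measure_iUnion (fun i j hij => (hd hij).mono Set.inter_subset_left Set.inter_subset_left)
          fun n => (hD n).inter (τ.continuous.measurable hB)
    _ = ∑' n, μ (τ.symm ⁻¹' disjointed E n ∩ B) := tsum_congr key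
    _ = μ (⋃ n, τ.symm ⁻¹' disjointed E n ∩ B) :=
        (measure_iUnion (fun i j hij => ((hd hij).preimage _).mono Set.inter_subset_left
          Set.inter_subset_left) fun n => (τ.symm.continuous.measurable (hD n)).inter hB).symm
    _ = μ B := by rw [← Set.iUnion_inter, ← Set.preimage_iUnion, hU, Set.preimage_univ,
        Set.univ_inter]

end Path

/-- Orbit equivalence of two systems. -/
def OrbitEquivalent (S S' : ToeplitzSystem) : Prop :=
  ∃ F : S.Path ≃ₜ S'.Path, ∀ z w : S.Path,
    (∃ k, w = Path.act k z) ↔ ∃ k, F w = Path.act k (F z)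

theorem OrbitEquivalent.symm {S S' : ToeplitzSystem} (h : OrbitEquivalent S S') :
    OrbitEquivalent S' S := by
  obtain ⟨F, hF⟩ := h
  exact ⟨F.symm, fun z w => by rw [hF]; simp⟩

theorem OrbitEquivalent.trans {S S' S'' : ToeplitzSystem} (h : OrbitEquivalent S S')
    (h' : OrbitEquivalent S' S'') : OrbitEquivalent S S'' := by
  obtain ⟨F, hF⟩ := h
  obtain ⟨G, hG⟩ := h'
  exact ⟨F.trans G, fun z w => by rw [hF, hG]; rfl⟩

theorem orbitEquivalent_iff (S S' : ToeplitzSystem) : OrbitEquivalent S S' ↔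
    SubshiftOrbitEquivalent (S.subshift : Set Cantor) (S'.subshift : Set Cantor) := by
  have hE : ∀ S : ToeplitzSystem, ∃ e : S.Path ≃ₜ (S.subshift : Set Cantor),
      ∀ z, (e z : Cantor) = z.code := fun S => ⟨Path.isEmbedding_code.toHomeomorph, fun z => rfl⟩
  obtain ⟨e, he⟩ := hE S
  obtain ⟨e', he'⟩ := hE S'
  constructor
  · rintro ⟨F, hF⟩
    refine ⟨(e.symm.trans F).trans e', fun x y => ?_⟩
    obtain ⟨z, rfl⟩ := e.surjective x
    obtain ⟨w, rfl⟩ := e.surjective y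
    simp only [Homeomorph.trans_apply, Homeomorph.symm_apply_apply, he, he',
      Path.code_mem_zOrbit_iff]
    exact hF z w
  · rintro ⟨f, hf⟩
    refine ⟨(e.trans f).trans e'.symm, fun z w => ?_⟩
    rw [← Path.code_mem_zOrbit_iff, ← Path.code_mem_zOrbit_iff, ← he, ← he, ← he', ← he', hf]
    simp

theorem map_map_act {S S' : ToeplitzSystem} {μ : Measure S.Path} (h : μ.map (Path.act 1) = μ)
    {F : S.Path ≃ₜ S'.Path} (hF : ∀ z w : S.Path,
      (∃ k, w = Path.act k z) ↔ ∃ k, F w = Path.act k (F z)) :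
    (μ.map F).map (Path.act 1) = μ.map F := by
  let α : S'.Path ≃ₜ S'.Path :=
    { toFun := Path.act 1
      invFun := Path.act (-1)
      left_inv := Path.act_neg_act 1
      right_inv := Path.act_act_neg 1
      continuous_toFun := Path.continuous_act 1
      continuous_invFun := Path.continuous_act (-1) }
  let τ : S.Path ≃ₜ S.Path := (F.trans α).trans F.symm
  have hτ : μ.map τ = μ := Path.map_of_orbit h τ fun z => (hF z (τ z)).2 ⟨1, by simp [τ, α]⟩
  conv_rhs => rw [← hτ]
  rw [Measure.map_map (Path.continuous_act 1).measurable F.continuous.measurable,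
    Measure.map_map F.continuous.measurable τ.continuous.measurable]
  congr 1
  funext z
  simp [τ, α]

end ToeplitzSystem

namespace ToeplitzSystem
variable {S : ToeplitzSystem}

/-! ### Invariant measures on cylinders -/

namespace Path

theorem pos_nonneg_lt (z : S.Path) (n : ℕ) : 0 ≤ z.pos n ∧ z.pos n < S.height n := by
  induction n with
  | zero => simp [pos, height]
  | succ n ih =>
    have h0 := z.digit_nonneg n
    have h1 := z.digit_lt n
    have h2 := S.height_pos n
    rw [pos, height]
    constructor <;> nlinarith

theorem carry_eq_ediv (z : S.Path) (k : ℤ) (n : ℕ) :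
    z.carry k n = (z.pos n + k) / S.height n := by
  induction n with
  | zero => simp [carry, pos, height]
  | succ n ih =>
    rw [carry, ih, height, ← Int.ediv_ediv_of_nonneg (S.height_pos n).le, pos,
      show z.pos n + z.digit n * S.height n + k = z.pos n + k + z.digit n * S.height n by ring,
      Int.add_mul_ediv_right _ _ (S.height_pos n).ne', add_comm]

theorem pos_act (z : S.Path) (k : ℤ) (n : ℕ) :
    (act k z).pos n = (z.pos n + k) % S.height n := by
  induction n with
  | zero => simp [pos, height]
  | succ n ih =>
    have h1 : (z.pos (n + 1) + k) % S.height n = (z.pos n + k) % S.height n := by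
      rw [pos, show z.pos n + z.digit n * S.height n + k = z.pos n + k + z.digit n * S.height n
        by ring, Int.add_mul_emod_self_right]
    have h2 : (z.pos (n + 1) + k) / S.height n = z.digit n + z.carry k n := by
      rw [carry_eq_ediv, pos,
        show z.pos n + z.digit n * S.height n + k = z.pos n + k + z.digit n * S.height n by ring,
        Int.add_mul_ediv_right _ _ (S.height_pos n).ne', add_comm]
    have h3 := Int.emod_add_mul_ediv ((z.pos (n + 1) + k) % S.height (n + 1)) (S.height n)
    rw [height, emod_mul_ediv_eq (S.height_pos n), Int.emod_emod_of_dvd _ (dvd_mul_right _ _), h1,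
      h2] at h3
    rw [pos, ih, digit_act, height, ← h3]
    ring

theorem continuous_pos (n : ℕ) : Continuous fun z : S.Path => z.pos n := by
  induction n with
  | zero => exact continuous_const
  | succ n ih => exact ih.add ((continuous_digit n).mul continuous_const)

/-- The cylinder of paths with a given vertex and position at stage `n`. -/
def cylinder (n : ℕ) (c : Vertex n × ℤ) : Set S.Path := {z | (z.vert n, z.pos n) = c}

theorem isClopen_cylinder (n : ℕ) (c : Vertex n × ℤ) : IsClopen (cylinder (S := S) n c) :=
  (isClopen_discrete {c}).preimage ((continuous_vert n).prodMk (continuous_pos n))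

theorem measurableSet_cylinder (n : ℕ) (c : Vertex n × ℤ) :
    MeasurableSet (cylinder (S := S) n c) :=
  (isClopen_cylinder n c).isOpen.measurableSet

theorem digit_eq_of_pos {z w : S.Path} {n : ℕ} (h : z.pos (n + 1) = w.pos (n + 1)) :
    z.pos n = w.pos n ∧ z.digit n = w.digit n := by
  have h1 := z.pos_nonneg_lt n
  have h2 := w.pos_nonneg_lt n
  have key : ∀ z : S.Path, z.pos n = z.pos (n + 1) % S.height n ∧
      z.digit n = z.pos (n + 1) / S.height n := fun z => by
    have h1 := z.pos_nonneg_lt n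
    rw [pos, Int.add_mul_emod_self_right, Int.emod_eq_of_lt h1.1 h1.2,
      Int.add_mul_ediv_right _ _ (S.height_pos n).ne', Int.ediv_eq_zero_of_lt h1.1 h1.2, zero_add]
    exact ⟨rfl, rfl⟩
  rw [(key z).1, (key z).2, (key w).1, (key w).2, h]
  exact ⟨rfl, rfl⟩

theorem eq_of_pos_eq {z w : S.Path} {n : ℕ} (h : (z.vert n, z.pos n) = (w.vert n, w.pos n)) {i : ℕ}
    (hi : i ≤ n) : (z.vert i, z.pos i) = (w.vert i, w.pos i) := by
  induction n with
  | zero => obtain rfl : i = 0 := by omega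
            exact h
  | succ n ih =>
    rcases hi.eq_or_lt with rfl | hi
    · exact h
    · refine ih ?_ (by omega)
      obtain ⟨h1, h2⟩ := digit_eq_of_pos (congrArg Prod.snd h)
      rw [vert_eq, h2, (Prod.mk.inj h).1, ← vert_eq, h1]

theorem exists_cylinder_subset {z : S.Path} {U : Set S.Path} (hU : U ∈ 𝓝 z) :
    ∃ n, cylinder n (z.vert n, z.pos n) ⊆ U := by
  obtain ⟨V, hV, hVU⟩ := (mem_nhds_induced Subtype.val z U).1 hU
  rw [nhds_pi] at hV
  obtain ⟨I, t, ht, hU⟩ := Filter.mem_pi'.1 hV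
  refine ⟨I.sup id + 1, fun w hw => hVU (hU fun i hi => ?_)⟩
  have hi' : i ≤ I.sup id := Finset.le_sup (f := id) hi
  have h1 := eq_of_pos_eq hw (i := i + 1) (by omega)
  have h2 := eq_of_pos_eq hw (i := i) (by omega)
  have h3 : w.1 i = z.1 i :=
    Prod.ext (Prod.mk.inj h2).1 (digit_eq_of_pos (Prod.mk.inj h1).2).2
  rw [h3]
  exact mem_of_mem_nhds (ht i)

theorem exists_uniform_cylinder {C : Set S.Path} (hC : IsClopen C) :
    ∃ n, ∀ z w : S.Path, (z.vert n, z.pos n) = (w.vert n, w.pos n) → z ∈ C → w ∈ C := by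
  let A : ℕ → Set S.Path := fun n =>
    {z | ∀ w w', w ∈ cylinder n (z.vert n, z.pos n) → w' ∈ cylinder n (z.vert n, z.pos n) →
      w ∈ C → w' ∈ C}
  have hA : ∀ n, IsOpen (A n) := fun n => by
    refine isOpen_iff_mem_nhds.2 fun z hz => Filter.mem_of_superset
      ((isClopen_cylinder n (z.vert n, z.pos n)).isOpen.mem_nhds rfl) fun w hw => ?_
    have hw' : (w.vert n, w.pos n) = (z.vert n, z.pos n) := hw
    change ∀ _ _, _
    rw [hw']
    exact hz
  have hmono : Monotone A := fun m n hmn z hz w w' hw hw' =>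
    hz w w' (eq_of_pos_eq hw hmn) (eq_of_pos_eq hw' hmn)
  obtain ⟨n, hn⟩ := isCompact_univ.elim_directed_cover A hA (fun z _ => by
    by_cases hz : z ∈ C
    · obtain ⟨n, hn⟩ := exists_cylinder_subset (hC.isOpen.mem_nhds hz)
      exact Set.mem_iUnion.2 ⟨n, fun w w' _ hw' _ => hn hw'⟩
    · obtain ⟨n, hn⟩ := exists_cylinder_subset (hC.compl.isOpen.mem_nhds hz)
      exact Set.mem_iUnion.2 ⟨n, fun w w' hw _ h => absurd h (hn hw)⟩)
    hmono.directed_le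
  exact ⟨n, fun z w h hz => hn (Set.mem_univ z) z w rfl h.symm hz⟩

theorem measureReal_cylinder {μ : Measure S.Path} (h : μ.map (act 1) = μ) (n : ℕ) (V : Vertex n)
    {p : ℤ} (h0 : 0 ≤ p) (h1 : p < S.height n) :
    μ.real (cylinder n (V, p)) = μ.real (cylinder n (V, 0)) := by
  induction p, h0 using Int.leInduction with
  | base => rfl
  | succ p hp ih =>
    rw [← ih (by omega)]
    conv_lhs => rw [← h]
    rw [map_measureReal_apply (continuous_act 1).measurable (measurableSet_cylinder _ _)]
    congr 1
    ext z
    have hz := z.pos_nonneg_lt n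
    simp only [cylinder, Set.mem_preimage, Set.mem_ofPred_eq, pos_act, vert_act, carry_eq_ediv,
      Prod.mk.injEq]
    rcases eq_or_lt_of_le (show z.pos n + 1 ≤ S.height n by omega) with h2 | h2
    · rw [h2, Int.emod_self]
      constructor <;> rintro ⟨-, h3⟩ <;> omega
    · rw [Int.emod_eq_of_lt (by omega) h2, Int.ediv_eq_zero_of_lt (by omega) h2, letters_zero]
      simp

theorem measureReal_eq_sum {μ : Measure S.Path} [IsFiniteMeasure μ] {C : Set S.Path} {n : ℕ}
    (P : Finset (Vertex n × ℤ)) (hC : ∀ z : S.Path, z ∈ C ↔ (z.vert n, z.pos n) ∈ P) :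
    μ.real C = ∑ c ∈ P, μ.real (cylinder n c) := by
  rw [← measureReal_biUnion_finset (fun c _ d _ hcd => ?_) fun c _ => measurableSet_cylinder n c]
  · congr 1
    ext z
    simp [hC, cylinder]
  · refine Set.disjoint_left.2 fun z hz hz' => hcd ?_
    exact Eq.trans (Eq.symm hz) hz'

/-- The measure of a clopen set is a sum of measures of base cylinders. -/
theorem measureReal_mem_of_isClopen {μ : Measure S.Path} [IsFiniteMeasure μ]
    (h : μ.map (act 1) = μ) (G : AddSubmonoid ℝ)
    (hG : ∀ n V, μ.real (cylinder n (V, 0)) ∈ G) {C : Set S.Path} (hC : IsClopen C) :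
    μ.real C ∈ G := by
  classical
  obtain ⟨n, hn⟩ := exists_uniform_cylinder hC
  rw [measureReal_eq_sum (n := n) ((Finset.univ ×ˢ Finset.Ico 0 (S.height n)).filter
    fun c => ∃ z ∈ C, (z.vert n, z.pos n) = c)]
  · refine sum_mem fun c hc => ?_
    simp only [Finset.mem_filter, Finset.mem_product, Finset.mem_Ico] at hc
    obtain ⟨V, p⟩ := c
    rw [measureReal_cylinder h n V hc.1.2.1 hc.1.2.2]
    exact hG n V
  · intro z
    simp only [Finset.mem_filter, Finset.mem_product, Finset.mem_Ico, Finset.mem_univ, true_and]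
    exact ⟨fun hz => ⟨z.pos_nonneg_lt n, z, hz, rfl⟩, fun ⟨_, w, hw, hwz⟩ => hn w z hwz hw⟩

end Path

variable (S) in
/-- The number of occurrences of the letter `U` in the word of `V`. -/
noncomputable def count (n : ℕ) (V : Vertex (n + 1)) (U : Vertex n) : ℕ :=
  ((Finset.Ico 0 (S.N n)).filter fun t => S.Θ n V t = U).card

variable (S) in
/-- The families of measures of base cylinders. -/
structure IsWeight (w : ∀ n, Vertex n → ℝ) : Prop where
  nonneg : ∀ n U, 0 ≤ w n U
  total : ∀ n, S.height n * ∑ U, w n U = 1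
  rec_eq : ∀ n U, w n U = ∑ V, S.count n V U * w (n + 1) V

theorem isWeight_measure {μ : Measure S.Path} [IsProbabilityMeasure μ]
    (h : μ.map (Path.act 1) = μ) :
    S.IsWeight fun n V => μ.real (Path.cylinder n (V, 0)) := by
  refine ⟨fun n U => measureReal_nonneg, fun n => ?_, fun n U => ?_⟩
  · have h1 := Path.measureReal_eq_sum (μ := μ) (C := Set.univ) (n := n)
      (Finset.univ ×ˢ Finset.Ico 0 (S.height n)) fun z => by simpa using z.pos_nonneg_lt n
    rw [probReal_univ, Finset.sum_product] at h1
    rw [h1, Finset.mul_sum]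
    refine Finset.sum_congr rfl fun V _ => ?_
    rw [Finset.sum_congr rfl fun p hp => Path.measureReal_cylinder h n V (Finset.mem_Ico.1 hp).1
      (Finset.mem_Ico.1 hp).2, Finset.sum_const, Int.card_Ico, nsmul_eq_mul, sub_zero]
    congr 1
    have := Int.toNat_of_nonneg (S.height_pos n).le
    exact_mod_cast this.symm
  · have hh := S.height_pos n
    have h1 := Path.measureReal_eq_sum (μ := μ) (C := Path.cylinder n (U, 0)) (n := n + 1)
      ((Finset.univ.sigma fun V => (Finset.Ico 0 (S.N n)).filter fun t => S.Θ n V t = U).map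
        ⟨fun x : (_ : Vertex (n + 1)) × ℤ => (x.1, x.2 * S.height n), fun x y hxy => by
          obtain ⟨h1, h2⟩ := Prod.ext_iff.1 hxy
          obtain ⟨V, t⟩ := x
          obtain ⟨V', t'⟩ := y
          simp only at h1 h2
          rw [h1, mul_right_cancel₀ hh.ne' h2]⟩) fun z => by
        have hp := z.pos_nonneg_lt n
        have hd0 := z.digit_nonneg n
        have hd1 := z.digit_lt n
        simp only [Path.cylinder, Set.mem_ofPred_eq, Finset.mem_map, Finset.mem_sigma,
          Finset.mem_univ, true_and, Finset.mem_filter, Finset.mem_Ico,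
          Prod.mk.injEq, Path.pos]
        constructor
        · rintro ⟨rfl, h2⟩
          exact ⟨⟨z.vert (n + 1), z.digit n⟩, ⟨⟨hd0, hd1⟩, (z.vert_eq n).symm⟩, by
            rw [h2, zero_add]
            rfl⟩
        · rintro ⟨⟨V, t⟩, ⟨h2, h3⟩, h45⟩
          obtain ⟨h4, h5⟩ : V = z.vert (n + 1) ∧ t * S.height n = z.pos n + z.digit n * S.height n :=
            Prod.mk.inj h45
          simp only at h2 h3
          have h6 : z.pos n = 0 := by
            have := congrArg (· % S.height n) h5
            simp only [Int.mul_emod_left, Int.add_mul_emod_self_right] at this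
            rw [← Int.emod_eq_of_lt hp.1 hp.2, ← this]
          refine ⟨?_, h6⟩
          rw [h6, zero_add] at h5
          rw [z.vert_eq n, ← h4, ← mul_right_cancel₀ hh.ne' h5, h3]
    rw [h1, Finset.sum_map, Finset.sum_sigma]
    refine Finset.sum_congr rfl fun V _ => ?_
    rw [count, ← nsmul_eq_mul, ← Finset.sum_const]
    refine Finset.sum_congr rfl fun t ht => ?_
    simp only [Finset.mem_filter, Finset.mem_Ico] at ht
    refine Path.measureReal_cylinder h _ _ (mul_nonneg ht.1.1 hh.le) ?_
    rw [height, mul_comm]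
    exact mul_lt_mul_of_pos_left ht.1.2 hh

theorem IsWeight.unique {w w' : ∀ n, Vertex n → ℝ} (h : S.IsWeight w) (h' : S.IsWeight w') :
    w = w' := by
  classical
  let D : ℕ → ℝ := fun n => S.height n * ∑ U, |w n U - w' n U|
  have hh : ∀ n, (0 : ℝ) < S.height n := fun n => by exact_mod_cast S.height_pos n
  have hsum : ∀ n, ∑ U, (w n U - w' n U) = 0 := fun n => by
    have := (h.total n).trans (h'.total n).symm
    rw [Finset.sum_sub_distrib, mul_left_cancel₀ (hh n).ne' this, sub_self]
  have h2 : ∀ n, D n ≤ 2 := fun n => by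
    calc D n ≤ S.height n * ∑ U, (w n U + w' n U) := by
          refine mul_le_mul_of_nonneg_left (Finset.sum_le_sum fun U _ => ?_) (hh n).le
          have := h.nonneg n U
          have := h'.nonneg n U
          rw [abs_le]
          constructor <;> linarith
      _ = 2 := by rw [Finset.sum_add_distrib, mul_add, h.total, h'.total]; norm_num
  have hD : ∀ n, 2 * D n ≤ D (n + 1) := fun n => by
    let p : ℤ → Prop := fun t => ∀ V V', S.Θ n V t = S.Θ n V' t
    let c : Vertex n → ℕ := fun U => (((Finset.Ico 0 (S.N n)).filter p).filter fun t =>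
      S.Θ n (fun _ => true) t = U).card
    let v : Vertex (n + 1) → Vertex n → ℕ := fun V U =>
      (((Finset.Ico 0 (S.N n)).filter fun t => ¬ p t).filter fun t => S.Θ n V t = U).card
    have hc : ∀ V U, S.count n V U = c U + v V U := fun V U => by
      have h1 : ((Finset.Ico 0 (S.N n)).filter p).filter (fun t => S.Θ n (fun _ => true) t = U) =
          ((Finset.Ico 0 (S.N n)).filter p).filter (fun t => S.Θ n V t = U) := by
        refine Finset.filter_congr fun t ht => ?_
        rw [(Finset.mem_filter.1 ht).2 V (fun _ => true)]
      simp only [c, v, h1]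
      rw [count, Finset.filter_comm, Finset.filter_comm (fun t => ¬ p t),
        Finset.card_filter_add_card_filter_not]
    have hv : ∀ V, 2 * ∑ U, (v V U : ℝ) ≤ S.N n := fun V => by
      have h1 : ∑ U, v V U = ((Finset.Ico 0 (S.N n)).filter fun t => ¬ p t).card :=
        (Finset.card_eq_sum_card_fiberwise fun t _ => Finset.mem_coe.2 (Finset.mem_univ _)).symm
      have h2 := S.reg n
      have h3 : {t : ℤ | 0 ≤ t ∧ t < S.N n ∧ ¬ ∀ V V', S.Θ n V t = S.Θ n V' t} =
          ((Finset.Ico 0 (S.N n)).filter fun t => ¬ p t : Finset ℤ) := by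
        ext t
        simp [p, and_assoc]
      rw [h3, Set.ncard_coe_finset, ← h1] at h2
      exact_mod_cast h2
    have hdiff : ∀ U, |w n U - w' n U| ≤ ∑ V, v V U * |w (n + 1) V - w' (n + 1) V| := fun U => by
      have : w n U - w' n U = ∑ V, v V U * (w (n + 1) V - w' (n + 1) V) := by
        have h1 : w n U - w' n U = ∑ V, (c U * (w (n + 1) V - w' (n + 1) V) +
            v V U * (w (n + 1) V - w' (n + 1) V)) := by
          rw [h.rec_eq, h'.rec_eq, ← Finset.sum_sub_distrib]
          refine Finset.sum_congr rfl fun V _ => ?_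
          rw [hc]
          push_cast
          ring
        rw [h1, Finset.sum_add_distrib, ← Finset.mul_sum, hsum, mul_zero, zero_add]
      rw [this]
      refine (Finset.abs_sum_le_sum_abs _ _).trans (Finset.sum_le_sum fun V _ => ?_)
      rw [abs_mul, Nat.abs_cast]
    calc 2 * D n ≤ 2 * (S.height n * ∑ U, ∑ V, v V U * |w (n + 1) V - w' (n + 1) V|) := by
          refine mul_le_mul_of_nonneg_left (mul_le_mul_of_nonneg_left
            (Finset.sum_le_sum fun U _ => hdiff U) (hh n).le) (by norm_num)
      _ = S.height n * ∑ V, (2 * ∑ U, (v V U : ℝ)) * |w (n + 1) V - w' (n + 1) V| := by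
          rw [Finset.sum_comm, Finset.mul_sum, Finset.mul_sum, Finset.mul_sum]
          refine Finset.sum_congr rfl fun V _ => ?_
          rw [← Finset.sum_mul]
          ring
      _ ≤ S.height n * ∑ V, S.N n * |w (n + 1) V - w' (n + 1) V| := by
          refine mul_le_mul_of_nonneg_left (Finset.sum_le_sum fun V _ =>
            mul_le_mul_of_nonneg_right (hv V) (abs_nonneg _)) (hh n).le
      _ = D (n + 1) := by
          simp only [D, height]
          rw [← Finset.mul_sum]
          push_cast
          ring
  have hpow : ∀ k n, 2 ^ k * D n ≤ 2 := by
    intro k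
    induction k with
    | zero => intro n; simpa using h2 n
    | succ k ih =>
      intro n
      calc (2 : ℝ) ^ (k + 1) * D n = 2 ^ k * (2 * D n) := by ring
        _ ≤ 2 ^ k * D (n + 1) := mul_le_mul_of_nonneg_left (hD n) (by positivity)
        _ ≤ 2 := ih _
  have hzero : ∀ n, D n ≤ 0 := fun n => by
    by_contra! hpos
    obtain ⟨k, hk⟩ := pow_unbounded_of_one_lt (2 / D n) (one_lt_two (α := ℝ))
    rw [div_lt_iff₀ hpos] at hk
    exact absurd (hpow k n) (not_le.2 hk)
  funext n U
  have h1 : ∑ U, |w n U - w' n U| ≤ 0 := by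
    by_contra! hpos
    exact absurd (hzero n) (not_le.2 (mul_pos (hh n) hpos))
  have h3 := (Finset.single_le_sum (f := fun U => |w n U - w' n U|) (fun V _ => abs_nonneg _)
    (Finset.mem_univ U)).trans h1
  exact sub_eq_zero.1 (abs_nonpos_iff.1 h3)

/-- If two systems are orbit equivalent, the measures of the clopen sets of the first are sums of
base cylinder measures of the second. -/
theorem OrbitEquivalent.measure_mem {S S' : ToeplitzSystem} (h : OrbitEquivalent S S')
    {w w' : ∀ n, Vertex n → ℝ} (hw : S.IsWeight w) (hw' : S'.IsWeight w') (G : AddSubmonoid ℝ)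
    (hG : ∀ n V, w' n V ∈ G) (V : Vertex 0) : w 0 V ∈ G := by
  have : IsEmbedding (Path.code : S.Path → Cantor) := Path.isEmbedding_code
  have : MetrizableSpace S.Path := this.metrizableSpace
  let _ := metrizableSpaceMetric S.Path
  have : Nonempty S.Path := ⟨S.minPath⟩
  obtain ⟨F, hF⟩ := h
  obtain ⟨μ, hμ, hinv⟩ := exists_invariant_measure (Path.continuous_act (S := S) 1)
  have hinv' := map_map_act hinv hF
  have : IsProbabilityMeasure (μ.map F) :=
    Measure.isProbabilityMeasure_map F.continuous.measurable.aemeasurable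
  have e := hw.unique (isWeight_measure hinv)
  have e' := hw'.unique (isWeight_measure hinv')
  have h1 := Path.measureReal_mem_of_isClopen hinv' G (fun n V => by rw [e'] at hG; exact hG n V)
    ((Path.isClopen_cylinder (S := S) 0 (V, 0)).preimage F.symm.continuous)
  rw [map_measureReal_apply F.continuous.measurable
    (F.symm.continuous.measurable (Path.measurableSet_cylinder _ _)), ← Set.preimage_comp] at h1
  rw [e]
  simpa using h1

end ToeplitzSystem

namespace ToeplitzSystem

/-! ### The systems attached to sequences of points of the Cantor space -/

/-- The number of paths below a vertex, coordinatewise. -/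
def coordHeight : ℕ → ℕ
  | 0 => 1
  | m + 1 => coordHeight m * (16 * coordHeight m) ^ (m + 1)

/-- The length of the words, coordinatewise. -/
def coordLength (m : ℕ) : ℕ := (16 * coordHeight m) ^ (m + 1)

theorem coordHeight_succ (m : ℕ) :
    coordHeight (m + 1) = coordHeight m * coordLength m := rfl

theorem coordHeight_pos (m : ℕ) : 0 < coordHeight m := by
  induction m with
  | zero => simp [coordHeight]
  | succ m ih => rw [coordHeight]; positivity

theorem coordHeight_mod (m : ℕ) : coordHeight m % 5 = 1 := by
  induction m with
  | zero => rfl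
  | succ m ih =>
    have : coordHeight m ≡ 1 [MOD 5] := ih
    have h16 : 16 ≡ 1 [MOD 5] := rfl
    have := this.mul ((h16.mul this).pow (m + 1))
    simpa [coordHeight, Nat.ModEq] using this

theorem coordLength_mod (m : ℕ) : coordLength m % 5 = 1 := by
  have : coordHeight m ≡ 1 [MOD 5] := coordHeight_mod m
  have h16 : 16 ≡ 1 [MOD 5] := rfl
  have := (h16.mul this).pow (m + 1)
  simpa [coordLength, Nat.ModEq] using this

theorem pow_le_coordLength (m : ℕ) : 16 ^ (m + 1) ≤ coordLength m :=
  Nat.pow_le_pow_left (by have := coordHeight_pos m; omega) _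

theorem sixteen_le_coordLength (m : ℕ) : 16 ≤ coordLength m :=
  le_trans (by rw [pow_succ]; have := Nat.one_le_pow m 16 (by norm_num); omega)
    (pow_le_coordLength m)

open scoped Classical in
/-- Whether `m` encodes a prefix of `x`. -/
noncomputable def isPrefix (x : ℕ → Bool) (m : ℕ) : Bool :=
  decide (∃ k, Encodable.encode ((List.range k).map x) = m)

/-- The word of length `q` attached to the letter `v`, with parameter `b`. -/
def bit (q : ℕ) (b v : Bool) (d : ℕ) : Bool :=
  if d = 7 then v else if d = 12 then b else decide (d % 5 = 0 ∧ d + 1 ≠ q)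

theorem bit_eq_true {q : ℕ} {b v : Bool} {d : ℕ} (h : bit q b v d = true) :
    d = 7 ∨ d = 12 ∨ (d % 5 = 0 ∧ d + 1 ≠ q) := by
  unfold bit at h
  split_ifs at h <;> simp_all

/-- The length of the word read in coordinate `i` at stage `n`. -/
abbrev coordSize (n : ℕ) (i : Fin (n + 1)) : ℕ := coordLength (n - i)

/-- Tuples of positions, one for each coordinate. -/
abbrev Digits (n : ℕ) : Type := (i : Fin (n + 1)) → Fin (coordSize n i)

/-- The length of the words at stage `n`. -/
def stageLength (n : ℕ) : ℕ := ∏ i, coordSize n i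

theorem sixteen_le_coordSize {n : ℕ} (i : Fin (n + 1)) : 16 ≤ coordSize n i :=
  sixteen_le_coordLength _

theorem coordSize_pos {n : ℕ} (i : Fin (n + 1)) : 0 < coordSize n i :=
  lt_of_lt_of_le (by norm_num) (sixteen_le_coordSize i)

theorem stageLength_pos (n : ℕ) : 0 < stageLength n :=
  Finset.prod_pos fun i _ => coordSize_pos i

theorem coordLength_le_stageLength (n : ℕ) : coordLength n ≤ stageLength n := by
  have h : coordSize n 0 ∣ stageLength n := Finset.dvd_prod_of_mem _ (Finset.mem_univ _)
  exact Nat.le_of_dvd (stageLength_pos n) h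

theorem sixteen_le_stageLength (n : ℕ) : 16 ≤ stageLength n :=
  (sixteen_le_coordLength n).trans (coordLength_le_stageLength n)

/-- The mixed radix encoding of a tuple of positions. -/
def encode {n : ℕ} (e : Digits n) : ℤ := ((finPiFinEquiv e : Fin (stageLength n)) : ℕ)

/-- The tuple of positions with a given code. -/
def decode (n : ℕ) (t : ℤ) : Digits n :=
  finPiFinEquiv.symm ⟨(t % stageLength n).toNat, by
    change _ < stageLength n
    have h := stageLength_pos n
    have h1 := Int.emod_nonneg t (b := stageLength n) (by omega)
    have h2 := Int.emod_lt_of_pos t (b := stageLength n) (by omega)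
    omega⟩

theorem encode_nonneg {n : ℕ} (e : Digits n) : 0 ≤ encode e := Int.natCast_nonneg _

theorem encode_lt {n : ℕ} (e : Digits n) : encode e < stageLength n :=
  Int.ofNat_lt.2 (finPiFinEquiv e : Fin (stageLength n)).2

theorem decode_encode {n : ℕ} (e : Digits n) : decode n (encode e) = e := by
  rw [decode, Equiv.symm_apply_eq]
  ext
  simp only [Int.emod_eq_of_lt (encode_nonneg e) (encode_lt e)]
  simp [encode]

theorem encode_decode {n : ℕ} {t : ℤ} (h0 : 0 ≤ t) (h1 : t < stageLength n) :
    encode (decode n t) = t := by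
  simp only [encode, decode, Equiv.apply_symm_apply, Int.emod_eq_of_lt h0 h1]
  omega

theorem encode_eq_sum {n : ℕ} (e : Digits n) : encode e =
    ∑ i : Fin (n + 1), ((e i : ℕ) : ℤ) *
      ∏ j : Fin i, ((coordSize n (Fin.castLE i.is_lt.le j) : ℕ) : ℤ) := by
  rw [encode, finPiFinEquiv_apply]
  push_cast
  rfl

theorem encode_mod {n : ℕ} (e : Digits n) : encode e % coordLength n = (e 0 : ℕ) := by
  rw [encode_eq_sum, Fin.sum_univ_succ]
  have h : ∀ i : Fin n, (coordLength n : ℤ) ∣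
      ∏ j : Fin (i.succ : Fin (n + 1)), ((coordSize n (Fin.castLE i.succ.is_lt.le j) : ℕ) : ℤ) := by
    intro i
    have := Finset.dvd_prod_of_mem
      (fun j : Fin (i.succ : Fin (n + 1)) => ((coordSize n (Fin.castLE i.succ.is_lt.le j) : ℕ) : ℤ))
      (Finset.mem_univ (⟨0, by simp⟩ : Fin (i.succ : Fin (n + 1))))
    simpa [coordSize] using this
  have h2 : (coordLength n : ℤ) ∣ ∑ i : Fin n, (((e i.succ : ℕ) : ℤ) *
      ∏ j : Fin (i.succ : Fin (n + 1)), ((coordSize n (Fin.castLE i.succ.is_lt.le j) : ℕ) : ℤ)) :=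
    Finset.dvd_sum fun i _ => (h i).mul_left _
  rw [Int.add_emod, Int.emod_eq_zero_of_dvd h2]
  have h3 : (e 0 : ℕ) < coordLength n := (e 0).2
  have h4 : ∏ j : Fin ((0 : Fin (n + 1)) : ℕ),
      ((coordSize n (Fin.castLE (0 : Fin (n + 1)).is_lt.le j) : ℕ) : ℤ) = 1 := rfl
  rw [h4, mul_one, add_zero, Int.emod_emod_of_dvd _ dvd_rfl]
  exact Int.emod_eq_of_lt (by omega) (by omega)

theorem decode_zero_coord {n : ℕ} {t : ℤ} (h0 : 0 ≤ t) (h1 : t < stageLength n) :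
    ((decode n t 0 : ℕ) : ℤ) = t % coordLength n := by
  rw [← encode_mod, encode_decode h0 h1]

theorem encode_mono {n : ℕ} {e e' : Digits n} (h : ∀ i, e i ≤ e' i) : encode e ≤ encode e' := by
  rw [encode_eq_sum, encode_eq_sum]
  refine Finset.sum_le_sum fun i _ => mul_le_mul_of_nonneg_right ?_ ?_
  · exact_mod_cast h i
  · exact Finset.prod_nonneg fun j _ => Int.natCast_nonneg _

theorem decode_zero (n : ℕ) (i : Fin (n + 1)) : (decode n 0 i : ℕ) = 0 := by
  have hN := stageLength_pos n
  have h : encode (fun i => ⟨0, coordSize_pos i⟩ : Digits n) ≤ encode (decode n 0) :=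
    encode_mono fun i => Nat.zero_le _
  rw [encode_decode le_rfl (by exact_mod_cast hN)] at h
  rw [← h.antisymm (encode_nonneg _), decode_encode]

theorem decode_last (n : ℕ) (i : Fin (n + 1)) :
    (decode n (stageLength n - 1) i : ℕ) + 1 = coordSize n i := by
  have hN := stageLength_pos n
  set e : Digits n := fun i => ⟨coordSize n i - 1, Nat.sub_lt (coordSize_pos i) one_pos⟩
  have h : encode (decode n (stageLength n - 1)) ≤ encode e :=
    encode_mono fun i => Nat.le_sub_one_of_lt (decode n (stageLength n - 1) i).2
  rw [encode_decode (by omega) (by omega)] at h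
  have h2 := encode_lt e
  rw [show (stageLength n : ℤ) - 1 = encode e by omega, decode_encode]
  exact Nat.sub_add_cancel (coordSize_pos i)

/-- The exchange of two positions used to remember the newest coordinate. -/
def markSwap (b : Bool) : Equiv.Perm ℤ := Equiv.swap 1 (if b then 10 else 5)

theorem markSwap_markSwap (b : Bool) (t : ℤ) : markSwap b (markSwap b t) = t :=
  Equiv.swap_apply_self _ _ _

theorem markSwap_cases (b : Bool) (t : ℤ) : (t = 1 ∧ b = true ∧ markSwap b t = 10) ∨
    (t = 1 ∧ b = false ∧ markSwap b t = 5) ∨ (t = 10 ∧ b = true ∧ markSwap b t = 1) ∨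
    (t = 5 ∧ b = false ∧ markSwap b t = 1) ∨ (t ≠ 1 ∧ (b = true → t ≠ 10) ∧ (b = false → t ≠ 5) ∧
      markSwap b t = t) := by
  cases b <;> simp only [markSwap, Equiv.swap_apply_def] <;> split_ifs <;> simp_all

theorem markSwap_nonneg {b : Bool} {t : ℤ} (h : 0 ≤ t) : 0 ≤ markSwap b t := by
  have := markSwap_cases b t
  omega

theorem markSwap_lt {b : Bool} {n : ℕ} {t : ℤ} (h : t < stageLength n) :
    markSwap b t < stageLength n := by
  have := markSwap_cases b t
  have := sixteen_le_stageLength n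
  omega

theorem markSwap_of_ne {b : Bool} {t : ℤ} (h1 : t ≠ 1) (h5 : t ≠ 5) (h10 : t ≠ 10) :
    markSwap b t = t := by
  have := markSwap_cases b t
  omega

/-- The substitution at stage `n`. -/
noncomputable def subst (c : ℕ → ℕ → Bool) (n : ℕ) (V : Vertex (n + 1)) (t : ℤ) : Vertex n := fun i =>
  bit (coordSize n i) (isPrefix (c i) (n - i)) (V i.castSucc)
    (decode n (markSwap (V (Fin.last _)) t) i)

theorem subst_markSwap_encode (c : ℕ → ℕ → Bool) (n : ℕ) (V : Vertex (n + 1)) (e : Digits n)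
    (i : Fin (n + 1)) : subst c n V (markSwap (V (Fin.last _)) (encode e)) i =
      bit (coordSize n i) (isPrefix (c i) (n - i)) (V i.castSucc) (e i) := by
  rw [subst, markSwap_markSwap, decode_encode]

theorem subst_zero_coord (c : ℕ → ℕ → Bool) (n : ℕ) (V : Vertex (n + 1)) {t : ℤ} (h0 : 0 ≤ t)
    (h1 : t < stageLength n) : ∃ d : ℕ, (d : ℤ) = markSwap (V (Fin.last _)) t % coordLength n ∧
      subst c n V t 0 = bit (coordLength n) (isPrefix (c 0) n) (V 0) d :=
  ⟨_, decode_zero_coord (markSwap_nonneg h0) (markSwap_lt h1), rfl⟩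

theorem card_digit_eq_seven (n : ℕ) (i : Fin (n + 1)) :
    coordSize n i * (Finset.univ.filter fun e : Digits n => (e i : ℕ) = 7).card =
      stageLength n := by
  have h : (Finset.univ.filter fun e : Digits n => (e i : ℕ) = 7) =
      Fintype.piFinset fun j => if j = i then Finset.univ.filter (fun d : Fin (coordSize n j) => (d : ℕ) = 7) else Finset.univ := by
    ext e
    simp only [Finset.mem_filter, Finset.mem_univ, true_and, Fintype.mem_piFinset]
    refine ⟨fun h j => ?_, fun h => by simpa using h i⟩
    split_ifs with hj
    · subst hj; simpa using h
    · simp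
  have h7 : ((Finset.univ : Finset (Fin (coordSize n i))).filter fun d : Fin (coordSize n i) => (d : ℕ) = 7).card = 1 := by
    rw [Finset.card_eq_one]
    refine ⟨⟨7, lt_of_lt_of_le (by norm_num) (sixteen_le_coordSize i)⟩, ?_⟩
    ext d
    simp [Fin.ext_iff]
  rw [h, Fintype.card_piFinset, ← Finset.mul_prod_erase _ _ (Finset.mem_univ i), if_pos rfl, h7,
    one_mul, stageLength, ← Finset.mul_prod_erase _ (coordSize n) (Finset.mem_univ i)]
  congr 1
  refine Finset.prod_congr rfl fun j hj => ?_
  rw [if_neg (Finset.ne_of_mem_erase hj), Finset.card_univ, Fintype.card_fin]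

theorem sum_card_digit_eq_seven_le (n : ℕ) :
    15 * ∑ i, (Finset.univ.filter fun e : Digits n => (e i : ℕ) = 7).card ≤ stageLength n := by
  have h1 : ∀ i : Fin (n + 1),
      ((Finset.univ.filter fun e : Digits n => (e i : ℕ) = 7).card : ℝ) ≤
        stageLength n * (1 / 16) ^ (n - i + 1 : ℕ) := by
    intro i
    have h := card_digit_eq_seven n i
    have h2 := Nat.mul_le_mul_right
      (Finset.univ.filter fun e : Digits n => (e i : ℕ) = 7).card (pow_le_coordLength (n - i))
    rw [show coordLength (n - i) = coordSize n i from rfl, h] at h2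
    have h3 : (16 : ℝ) ^ (n - i + 1 : ℕ) *
        (Finset.univ.filter fun e : Digits n => (e i : ℕ) = 7).card ≤ stageLength n := by
      exact_mod_cast h2
    rw [one_div, inv_pow, ← div_eq_mul_inv, le_div_iff₀ (by positivity)]
    linarith
  have h2 : ∑ i : Fin (n + 1), (1 / 16 : ℝ) ^ (n - i + 1 : ℕ) ≤ 1 / 15 := by
    rw [Fin.sum_univ_eq_sum_range (fun i => (1 / 16 : ℝ) ^ (n - i + 1 : ℕ)),
      Finset.sum_congr rfl fun i _ => by rw [show n - i = n + 1 - 1 - i by omega],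
      Finset.sum_range_reflect (fun i => (1 / 16 : ℝ) ^ (i + 1)) (n + 1)]
    simp_rw [pow_succ]
    rw [← Finset.sum_mul, geom_sum_eq (by norm_num)]
    have : (0 : ℝ) < (1 / 16) ^ n := by positivity
    rw [pow_succ, show ((1 / 16 : ℝ) ^ n * (1 / 16) - 1) / (1 / 16 - 1) * (1 / 16) =
      1 / 15 - (1 / 16) ^ n * (1 / 240) by ring]
    linarith
  have h3 := Finset.sum_le_sum fun i (_ : i ∈ Finset.univ) => h1 i
  rw [← Finset.mul_sum] at h3
  have h4 : (0 : ℝ) ≤ stageLength n := by positivity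
  have h5 := mul_le_mul_of_nonneg_left h2 h4
  have h6 : (15 * ∑ i, (Finset.univ.filter fun e : Digits n => (e i : ℕ) = 7).card : ℝ) ≤
    stageLength n := by push_cast; linarith
  exact_mod_cast h6

theorem nonconstant_subset (c : ℕ → ℕ → Bool) (n : ℕ) :
    {t : ℤ | 0 ≤ t ∧ t < stageLength n ∧ ¬ ∀ V V', subst c n V t = subst c n V' t} ⊆
      (({1, 5, 10} : Finset ℤ) ∪ (Finset.univ.biUnion fun i =>
        (Finset.univ.filter fun e : Digits n => (e i : ℕ) = 7).image encode) : Finset ℤ) := by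
  rintro t ⟨h0, h1, h⟩
  by_contra hcon
  rw [Finset.mem_coe, Finset.mem_union, not_or] at hcon
  obtain ⟨h2, h3⟩ := hcon
  simp only [Finset.mem_insert, Finset.mem_singleton, not_or] at h2
  refine h fun V V' => funext fun i => ?_
  have h7 : (decode n t i : ℕ) ≠ 7 := by
    intro h7
    refine h3 (Finset.mem_biUnion.2 ⟨i, Finset.mem_univ _, Finset.mem_image.2
      ⟨decode n t, by simpa using h7, encode_decode h0 h1⟩⟩)
  simp only [subst, markSwap_of_ne h2.1 h2.2.1 h2.2.2, bit, if_neg h7]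

theorem two_mul_ncard_nonconstant_le (c : ℕ → ℕ → Bool) (n : ℕ) :
    2 * {t : ℤ | 0 ≤ t ∧ t < stageLength n ∧ ¬ ∀ V V', subst c n V t = subst c n V' t}.ncard ≤
      stageLength n := by
  have h1 := Set.ncard_le_ncard (nonconstant_subset c n) (Finset.finite_toSet _)
  rw [Set.ncard_coe_finset] at h1
  have h2 := h1.trans (Finset.card_union_le _ _)
  have h3 : (Finset.univ.biUnion fun i =>
      (Finset.univ.filter fun e : Digits n => (e i : ℕ) = 7).image encode).card ≤
      ∑ i, (Finset.univ.filter fun e : Digits n => (e i : ℕ) = 7).card :=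
    Finset.card_biUnion_le.trans (Finset.sum_le_sum fun i _ => Finset.card_image_le)
  have h4 := sum_card_digit_eq_seven_le n
  have h5 : ({1, 5, 10} : Finset ℤ).card = 3 := by decide
  have h6 := sixteen_le_stageLength n
  omega

/-- The system attached to a sequence of points of the Cantor space. -/
noncomputable def system (c : ℕ → ℕ → Bool) : ToeplitzSystem where
  N n := stageLength n
  Θ := subst c
  firstLetter _ _ := true
  lastLetter _ _ := false
  two_le n := by have := sixteen_le_stageLength n; omega
  first n V := by
    funext i
    rw [subst, markSwap_of_ne (by norm_num) (by norm_num) (by norm_num), decode_zero]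
    have := sixteen_le_coordSize i
    simp [bit]
    omega
  last n V := by
    funext i
    have h := sixteen_le_stageLength n
    have h1 := decode_last n i
    have h2 := sixteen_le_coordSize i
    rw [subst, markSwap_of_ne (by omega) (by omega) (by omega)]
    unfold bit
    rw [if_neg (by omega), if_neg (by omega), decide_eq_false]
    exact fun h => h.2 h1
  mark_zero _ := rfl
  mark_one n V := by
    have hN := sixteen_le_stageLength n
    have hq := sixteen_le_coordLength n
    obtain ⟨d, hd, h⟩ := subst_zero_coord c n V (t := 1) (by norm_num) (by omega)
    have hm := markSwap_cases (V (Fin.last _)) 1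
    have h10 : ∀ k : ℤ, 0 ≤ k → k < 16 → k % coordLength n = k := fun k h h' =>
      Int.emod_eq_of_lt h (by omega)
    have hd' : d = 10 ∨ d = 5 := by
      rcases hm with h | h | h | h | h
      · rw [h.2.2, h10 _ (by norm_num) (by norm_num)] at hd; omega
      · rw [h.2.2, h10 _ (by norm_num) (by norm_num)] at hd; omega
      all_goals omega
    rw [h]
    rcases hd' with rfl | rfl <;> simp [bit] <;> omega
  mark_ne n V t ht ht' := by
    rintro ⟨ha, hb⟩
    have hN := sixteen_le_stageLength n
    have hq := sixteen_le_coordLength n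
    have hq5 := coordLength_mod n
    obtain ⟨d, hd, h⟩ := subst_zero_coord c n V (t := t) (by omega) (by omega)
    obtain ⟨d', hd', h'⟩ := subst_zero_coord c n V (t := t + 1) (by omega) (by omega)
    rw [h] at ha
    rw [h'] at hb
    have ha := bit_eq_true ha
    have hb := bit_eq_true hb
    have hm := markSwap_cases (V (Fin.last _)) t
    have hm' := markSwap_cases (V (Fin.last _)) (t + 1)
    have hs : ∀ k : ℤ, 0 ≤ k → k < 16 → k % coordLength n = k := fun k h h' =>
      Int.emod_eq_of_lt h (by omega)
    have hsucc : (t + 1) % coordLength n = t % coordLength n + 1 ∨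
        ((t + 1) % coordLength n = 0 ∧ t % coordLength n + 1 = coordLength n) := by
      have h1 := Int.emod_nonneg t (b := coordLength n) (by omega)
      have h2 := Int.emod_lt_of_pos t (b := coordLength n) (by omega)
      rcases eq_or_ne (t % coordLength n + 1) (coordLength n : ℤ) with h | h
      · right
        refine ⟨?_, h⟩
        rw [← Int.emod_add_emod, h, Int.emod_self]
      · left
        rw [← Int.emod_add_emod, Int.emod_eq_of_lt (by omega) (by omega)]
    rcases lt_or_ge t 15 with hlt | hge
    · have e1 := hs t (by omega) (by omega)
      have e2 := hs (t + 1) (by omega) (by omega)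
      rw [hs _ (markSwap_nonneg (by omega)) (by omega)] at hd hd'
      omega
    · rw [show markSwap (V (Fin.last _)) t = t by omega] at hd
      rw [show markSwap (V (Fin.last _)) (t + 1) = t + 1 by omega] at hd'
      omega
  mark_last _ := rfl
  inj n V V' h := by
    have hN := sixteen_le_stageLength n
    have hq := sixteen_le_coordLength n
    have key : ∀ W : Vertex (n + 1), subst c n W 5 0 = W (Fin.last _) := by
      intro W
      obtain ⟨d, hd, h⟩ := subst_zero_coord c n W (t := 5) (by norm_num) (by omega)
      rw [h]
      rcases hW : W (Fin.last _) with _ | _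
      · rw [hW, show markSwap false 5 = 1 from rfl, Int.emod_eq_of_lt (by omega) (by omega)] at hd
        obtain rfl : d = 1 := by omega
        simp [bit]
      · rw [hW, show markSwap true 5 = 5 from rfl, Int.emod_eq_of_lt (by omega) (by omega)] at hd
        obtain rfl : d = 5 := by omega
        simp [bit]; omega
    have hlast : V (Fin.last _) = V' (Fin.last _) := by
      rw [← key V, ← key V', h 5 (by omega) (by omega)]
    refine funext fun i => Fin.lastCases hlast (fun i => ?_) i
    set e : Digits n := fun j => ⟨7, lt_of_lt_of_le (by norm_num) (sixteen_le_coordSize _)⟩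
    have h1 := congrFun (h (markSwap (V (Fin.last _)) (encode e)) (markSwap_nonneg (encode_nonneg _))
      (markSwap_lt (encode_lt _))) i
    rw [subst_markSwap_encode, hlast, subst_markSwap_encode] at h1
    simpa [bit, e] using h1
  occ n V U := by
    set e : Digits n := fun i => ⟨if U i then 0 else 1, by
      have := sixteen_le_coordSize i; exact lt_of_le_of_lt (b := 1) (by split_ifs <;> omega) (by omega)⟩
    refine ⟨markSwap (V (Fin.last _)) (encode e), markSwap_nonneg (encode_nonneg _),
      markSwap_lt (encode_lt _), funext fun i => ?_⟩
    have := sixteen_le_coordSize i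
    rw [subst_markSwap_encode]
    rcases h : U i with _ | _ <;> simp [bit, e, h]
    omega
  reg n := by exact_mod_cast two_mul_ncard_nonconstant_le c n

end ToeplitzSystem

namespace ToeplitzSystem

/-! ### Permuting the coordinates -/

/-- The path space of `system c` in coordinates. -/
def CoordPath (c : ℕ → ℕ → Bool) : Type :=
  {ζ : ℕ → ℕ → Bool × ℕ // ∀ i m, (ζ i m).2 < coordLength m ∧
    (ζ i m).1 = bit (coordLength m) (isPrefix (c i) m) (ζ i (m + 1)).1 (ζ i m).2}

instance (c : ℕ → ℕ → Bool) : TopologicalSpace (CoordPath c) := instTopologicalSpaceSubtype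

instance (c : ℕ → ℕ → Bool) : T2Space (CoordPath c) := inferInstanceAs (T2Space (Subtype _))

/-- The coordinate `i` of a vertex at stage `i + m`. -/
abbrev coordIndex (i m : ℕ) : Fin (i + m + 1) := ⟨i, by omega⟩

theorem coordSize_coordIndex (i m : ℕ) : coordSize (i + m) (coordIndex i m) = coordLength m := by
  simp [coordSize]

variable {c c' : ℕ → ℕ → Bool}

/-- The coordinates of a path. -/
noncomputable def toCoord (z : (system c).Path) : CoordPath c :=
  ⟨fun i m => (z.vert (i + m) (coordIndex i m),
    (decode (i + m) (markSwap (z.vert (i + m + 1) (Fin.last _)) (z.digit (i + m)))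
      (coordIndex i m) : ℕ)), fun i m => by
    constructor
    · exact (Fin.is_lt _).trans_eq (coordSize_coordIndex i m)
    · have h := congrFun (z.vert_eq (i + m)) (coordIndex i m)
      simp only [system, subst, coordSize, Nat.add_sub_cancel_left] at h
      exact h⟩

/-- The tuples of positions of the path with given coordinates. -/
def CoordPath.digits (ζ : CoordPath c) (n : ℕ) : Digits n := fun i => ⟨(ζ.1 i (n - i)).2, (ζ.2 _ _).1⟩

/-- The path with given coordinates. -/
noncomputable def ofCoord (ζ : CoordPath c) : (system c).Path :=
  ⟨fun n => (fun i => (ζ.1 i (n - i)).1, markSwap (ζ.1 (n + 1) 0).1 (encode (ζ.digits n))), fun n => by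
    refine ⟨markSwap_nonneg (encode_nonneg _), markSwap_lt (encode_lt _), funext fun i => ?_⟩
    have h := subst_markSwap_encode c n (fun i => (ζ.1 i (n + 1 - i)).1) (ζ.digits n) i
    simp only [Fin.val_last, Nat.sub_self, Fin.val_castSucc] at h
    refine Eq.trans ?_ h.symm
    change (ζ.1 i (n - i)).1 = _
    rw [(ζ.2 i (n - i)).2, show n + 1 - i = n - i + 1 by have := i.2; omega]
    rfl⟩

theorem vert_congr {S : ToeplitzSystem} (z : S.Path) {n n' : ℕ} (h : n' = n) (i : Fin (n + 1)) :
    z.vert n' ⟨i, by omega⟩ = z.vert n i := by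
  subst h
  rfl

theorem ofCoord_toCoord (z : (system c).Path) : ofCoord (toCoord z) = z := by
  refine Path.ext' (fun n => ?_) (fun n => ?_)
  · funext i
    have hi : i + (n - i) = n := by have := i.2; omega
    change z.vert (i + (n - i)) _ = z.vert n i
    exact vert_congr z hi i
  · have hd : (toCoord z).digits n = decode n (markSwap (z.vert (n + 1) (Fin.last _)) (z.digit n)) := by
      funext i
      have hi : i + (n - i) = n := by have := i.2; omega
      apply Fin.ext
      change (decode (i + (n - i)) (markSwap (z.vert (i + (n - i) + 1) (Fin.last _))
        (z.digit (i + (n - i)))) ⟨i, _⟩ : ℕ) = _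
      congr!
    change markSwap (z.vert (n + 1 + 0) _) (encode ((toCoord z).digits n)) = _
    rw [hd, encode_decode (markSwap_nonneg (z.digit_nonneg n)) (markSwap_lt (z.digit_lt n))]
    exact markSwap_markSwap _ _

theorem toCoord_ofCoord (ζ : CoordPath c) : toCoord (ofCoord ζ) = ζ := by
  refine Subtype.ext (funext fun i => funext fun m => Prod.ext ?_ ?_)
  · change (ζ.1 i (i + m - i)).1 = _
    rw [Nat.add_sub_cancel_left]
  · change (decode (i + m) (markSwap (ζ.1 (i + m + 1) (i + m + 1 - (i + m + 1))).1
      (markSwap (ζ.1 (i + m + 1) 0).1 (encode (ζ.digits (i + m))))) (coordIndex i m) : ℕ) = _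
    rw [Nat.sub_self, markSwap_markSwap, decode_encode]
    change (ζ.1 i (i + m - i)).2 = _
    rw [Nat.add_sub_cancel_left]

/-- Paths are determined by their coordinates. -/
noncomputable def coordEquiv (c : ℕ → ℕ → Bool) : (system c).Path ≃ CoordPath c :=
  ⟨toCoord, ofCoord, ofCoord_toCoord, toCoord_ofCoord⟩

theorem continuous_toCoord : Continuous (toCoord : (system c).Path → CoordPath c) := by
  refine Continuous.subtype_mk (continuous_pi fun i => continuous_pi fun m => ?_) _
  have h1 := Path.continuous_vert (S := system c) (i + m)
  have h2 := Path.continuous_vert (S := system c) (i + m + 1)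
  have h3 := Path.continuous_digit (S := system c) (i + m)
  exact (continuous_of_discreteTopology (f := fun p : Vertex (i + m) × Vertex (i + m + 1) × ℤ =>
    (p.1 (coordIndex i m), (decode (i + m) (markSwap (p.2.1 (Fin.last _)) p.2.2)
      (coordIndex i m) : ℕ)))).comp (h1.prodMk (h2.prodMk h3))

/-- Paths are homeomorphic to their coordinates. -/
noncomputable def coordHomeomorph (c : ℕ → ℕ → Bool) : (system c).Path ≃ₜ CoordPath c :=
  Continuous.homeoOfEquivCompactToT2 (f := coordEquiv c) continuous_toCoord

instance : CompactSpace (CoordPath c) := (coordHomeomorph c).compactSpace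

theorem tailEq_iff (z w : (system c).Path) : z.TailEq w ↔
    {p : ℕ × ℕ | (toCoord z).1 p.1 p.2 ≠ (toCoord w).1 p.1 p.2}.Finite := by
  constructor
  · rintro ⟨m, h⟩
    refine (((Set.finite_lt_nat m).prod (Set.finite_lt_nat m))).subset fun p hp => ?_
    by_contra hcon
    simp only [Set.mem_prod, Set.mem_ofPred_eq, not_and_or, not_lt] at hcon
    have hm : m ≤ p.1 + p.2 := by omega
    refine hp (Prod.ext ?_ ?_)
    · exact congrFun (h _ hm).1 _
    · simp only [toCoord, (h _ hm).2, (h _ (hm.trans (Nat.le_succ _))).1]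
  · intro h
    obtain ⟨m, hm⟩ : ∃ m, ∀ i k, m ≤ i + k → (toCoord z).1 i k = (toCoord w).1 i k := by
      obtain ⟨m, hm⟩ := (h.image fun p => p.1 + p.2).bddAbove
      refine ⟨m + 1, fun i k hk => ?_⟩
      by_contra hcon
      have := hm ⟨(i, k), hcon, rfl⟩
      simp only at this
      omega
    refine ⟨m, fun n hn => ?_⟩
    rw [← ofCoord_toCoord z, ← ofCoord_toCoord w]
    have h1 : ∀ i : Fin (n + 1), (toCoord z).1 i (n - i) = (toCoord w).1 i (n - i) := fun i =>
      hm _ _ (by have := i.2; omega)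
    have h2 : (toCoord z).digits n = (toCoord w).digits n :=
      funext fun i => Fin.ext (congrArg Prod.snd (h1 i))
    constructor
    · funext i
      exact congrArg Prod.fst (h1 i)
    · change markSwap ((toCoord z).1 (n + 1) 0).1 _ = markSwap ((toCoord w).1 (n + 1) 0).1 _
      rw [h2, hm (n + 1) 0 (by omega)]

theorem toCoord_minPath (i m : ℕ) : (toCoord (system c).minPath).1 i m = (true, 0) := by
  refine Prod.ext rfl ?_
  change (decode (i + m) (markSwap _ 0) _ : ℕ) = 0
  rw [markSwap_of_ne (by norm_num) (by norm_num) (by norm_num), decode_zero]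

theorem toCoord_maxPath (i m : ℕ) :
    (toCoord (system c).maxPath).1 i m = (false, coordLength m - 1) := by
  refine Prod.ext rfl ?_
  have h := sixteen_le_stageLength (i + m)
  change (decode (i + m) (markSwap _ (stageLength (i + m) - 1)) _ : ℕ) = _
  rw [markSwap_of_ne (by omega) (by omega) (by omega)]
  have h1 := decode_last (i + m) (coordIndex i m)
  have h2 := coordSize_coordIndex i m
  simp only
  omega

/-- Reindexing the coordinates. -/
def reindex (c : ℕ → ℕ → Bool) (π : Equiv.Perm ℕ) : CoordPath c ≃ CoordPath (c ∘ π) where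
  toFun ζ := ⟨fun i => ζ.1 (π i), fun i => ζ.2 (π i)⟩
  invFun ζ := ⟨fun i => ζ.1 (π.symm i), fun i m => by simpa using ζ.2 (π.symm i) m⟩
  left_inv ζ := Subtype.ext (funext fun i => by simp)
  right_inv ζ := Subtype.ext (funext fun i => by simp)

theorem continuous_reindex (π : Equiv.Perm ℕ) : Continuous (reindex c π) :=
  Continuous.subtype_mk (f := fun ζ : CoordPath c => fun i => ζ.1 (π i)) (continuous_pi fun i =>
    (continuous_apply (π i)).comp continuous_subtype_val) fun ζ i => ζ.2 (π i)

theorem orbitEquivalent_comp_perm (c : ℕ → ℕ → Bool) (π : Equiv.Perm ℕ) :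
    OrbitEquivalent (system c) (system (c ∘ π)) := by
  set F : (system c).Path ≃ₜ (system (c ∘ π)).Path := (coordHomeomorph c).trans
    ((Continuous.homeoOfEquivCompactToT2 (f := reindex c π) (continuous_reindex π)).trans
      (coordHomeomorph (c ∘ π)).symm)
  have hF : ∀ z i m, (toCoord (F z)).1 i m = (toCoord z).1 (π i) m := fun z i m =>
    congrFun (congrFun (congrArg Subtype.val (toCoord_ofCoord (reindex c π (toCoord z)))) i) m
  have key : ∀ f g : ℕ → ℕ → Bool × ℕ, {p : ℕ × ℕ | f p.1 p.2 ≠ g p.1 p.2}.Finite ↔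
      {p : ℕ × ℕ | f (π p.1) p.2 ≠ g (π p.1) p.2}.Finite := by
    intro f g
    exact ⟨fun h => h.preimage (f := π.prodCongr (Equiv.refl ℕ)) (Equiv.injective _).injOn,
      fun h => Set.Finite.of_preimage (f := π.prodCongr (Equiv.refl ℕ)) h (Equiv.surjective _)⟩
  refine ⟨F, fun z w => ?_⟩
  rw [Path.exists_act_iff, Path.exists_act_iff]
  simp only [tailEq_iff, hF, toCoord_minPath, toCoord_maxPath]
  rw [key (toCoord z).1 (toCoord w).1, key _ fun _ _ => (true, 0), key _ fun _ _ => (true, 0),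
    key _ fun _ m => (false, coordLength m - 1), key _ fun _ m => (false, coordLength m - 1)]

end ToeplitzSystem

namespace ToeplitzSystem

/-- Repeats every term of a sequence infinitely often. -/
def inflate {X : Type*} (a : ℕ → X) : ℕ → X := fun n => a (Nat.unpair n).1

theorem range_inflate {X : Type*} (a : ℕ → X) : Set.range (inflate a) = Set.range a := by
  ext x
  constructor
  · rintro ⟨n, rfl⟩
    exact ⟨_, rfl⟩
  · rintro ⟨n, rfl⟩
    exact ⟨Nat.pair n 0, by simp [inflate]⟩

theorem nonempty_fiber_equiv {X : Type*} {a b : ℕ → X} (h : Set.range a = Set.range b) (x : X) :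
    Nonempty ({n // inflate a n = x} ≃ {n // inflate b n = x}) := by
  by_cases hx : x ∈ Set.range a
  · have hinf : ∀ a : ℕ → X, x ∈ Set.range a → Nonempty ({n // inflate a n = x} ≃ ℕ) := by
      rintro a ⟨j, hj⟩
      have : Infinite {n // inflate a n = x} :=
        Infinite.of_injective (fun k => ⟨Nat.pair j k, by simp [inflate, hj]⟩)
          (fun k l hkl => (Nat.pair_eq_pair.1 (congrArg Subtype.val hkl)).2)
      obtain ⟨d⟩ := nonempty_denumerable {n // inflate a n = x}
      exact ⟨Denumerable.eqv _⟩
    obtain ⟨e⟩ := hinf a hx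
    obtain ⟨e'⟩ := hinf b (h ▸ hx)
    exact ⟨e.trans e'.symm⟩
  · have he : ∀ a : ℕ → X, x ∉ Set.range a → IsEmpty {n // inflate a n = x} := fun a hx =>
      ⟨fun n => hx ⟨_, n.2⟩⟩
    have := he a hx
    have := he b (h ▸ hx)
    exact ⟨Equiv.equivOfIsEmpty _ _⟩

theorem exists_perm_inflate {X : Type*} {a b : ℕ → X} (h : Set.range a = Set.range b) :
    ∃ π : Equiv.Perm ℕ, inflate a = inflate b ∘ π := by
  refine ⟨(Equiv.sigmaFiberEquiv (inflate a)).symm.trans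
    ((Equiv.sigmaCongrRight fun x => (nonempty_fiber_equiv h x).some).trans
      (Equiv.sigmaFiberEquiv (inflate b))), funext fun n => ?_⟩
  exact ((nonempty_fiber_equiv h (inflate a n)).some ⟨n, rfl⟩).2.symm

/-! ### Continuity of the subshift in the parameter -/

theorem continuous_isPrefix (m : ℕ) : Continuous fun x => isPrefix x m := by
  by_cases h : ∃ l : List Bool, Encodable.encode l = m
  · obtain ⟨l, rfl⟩ := h
    have key : (fun x => isPrefix x (Encodable.encode l)) =
        (fun f : Fin l.length → Bool => decide (List.ofFn f = l)) ∘ fun x i => x i := by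
      funext x
      have h1 : List.ofFn (fun i : Fin l.length => x i) = (List.range l.length).map x :=
        List.ext_getElem (by simp) (by simp)
      simp only [isPrefix, Function.comp_apply, h1, decide_eq_decide, Encodable.encode_inj]
      refine ⟨fun ⟨k, hk⟩ => ?_, fun h => ⟨_, h⟩⟩
      have : k = l.length := by rw [← hk]; simp
      rwa [← this]
    rw [key]
    exact continuous_of_discreteTopology.comp (continuous_pi fun i => continuous_apply _)
  · have key : (fun x => isPrefix x m) = fun _ => false := by
      funext x
      simp only [isPrefix, decide_eq_false_iff_not]
      exact fun ⟨k, hk⟩ => h ⟨_, hk⟩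
    rw [key]
    exact continuous_const

theorem eventually_subst_eq (c : ℕ → ℕ → Bool) (n : ℕ) :
    ∀ᶠ c' in 𝓝 c, subst c' n = subst c n := by
  have h : ∀ i : Fin (n + 1), ∀ᶠ c' in 𝓝 c, isPrefix (c' i) (n - i) = isPrefix (c i) (n - i) := by
    intro i
    have hc : Continuous fun c : ℕ → ℕ → Bool => isPrefix (c i) (n - i) :=
      (continuous_isPrefix _).comp (continuous_apply _)
    exact (hc.tendsto c).eventually ((isOpen_discrete {isPrefix (c i) (n - i)}).mem_nhds rfl)
  filter_upwards [Filter.eventually_all.2 h] with c' hc'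
  funext V t i
  rw [subst, subst, hc' i]

theorem approx_minPath_congr {c c' : ℕ → ℕ → Bool} (k n : ℕ) (h : ∀ m, m < n + k →
    subst c m = subst c' m) (j : ℤ) :
    (system c).minPath.approx k n j = (system c').minPath.approx k n j := by
  induction k generalizing n j with
  | zero => rfl
  | succ k ih =>
    rw [Path.approx_step, Path.approx_step, ih (n + 1) fun m hm => h m (by omega)]
    exact congrFun (congrFun (h n (by omega)) _) _

theorem eventually_code_minPath_eq (c : ℕ → ℕ → Bool) (k : ℕ) : ∀ᶠ c' in 𝓝 c, ∀ j : ℤ,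
    j.natAbs ≤ k → (system c').minPath.code j = (system c).minPath.code j := by
  have h := (Set.finite_lt_nat k).eventually_all (l := 𝓝 c)
    (p := fun m c' => subst c' m = subst c m)
  filter_upwards [h.2 fun m _ => eventually_subst_eq c m] with c' hc' j hj
  simp only [Path.code, ← Path.approx_eq _ _ hj]
  exact congrFun (approx_minPath_congr k 0 (fun m hm => hc' m (by simpa using hm)) j) 0

theorem exists_mem_subshift_window {c c' : ℕ → ℕ → Bool} {n R : ℕ}
    (hR : returnBound (system c).N n 0 ≤ R)
    (h : ∀ j : ℤ, j.natAbs ≤ n + R → (system c').minPath.code j = (system c).minPath.code j)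
    {x : Cantor} (hx : x ∈ (system c).subshift) :
    ∃ y ∈ (system c').subshift, ∀ j : ℤ, j.natAbs ≤ n → y j = x j := by
  rw [← SetLike.mem_coe, coe_subshift] at hx
  obtain ⟨z, rfl⟩ := hx
  obtain ⟨k, hk, hj⟩ := z.exists_return n 0
  have hk' := abs_le.1 hk
  refine ⟨(Path.act k (system c').minPath).code, ?_, fun j hjn => ?_⟩
  · rw [← SetLike.mem_coe, coe_subshift]
    exact ⟨_, rfl⟩
  · rw [Path.eq_act_iff_code.1 rfl j, h _ (by omega)]
    exact congrFun (hj j hjn) 0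

theorem exists_eventually_window (c : ℕ → ℕ → Bool) (n : ℕ) : ∀ᶠ c' in 𝓝 c,
    (∀ x ∈ (system c).subshift, ∃ y ∈ (system c').subshift, ∀ j : ℤ, j.natAbs ≤ n → y j = x j) ∧
    ∀ x ∈ (system c').subshift, ∃ y ∈ (system c).subshift, ∀ j : ℤ, j.natAbs ≤ n → y j = x j := by
  have hR : returnBound (system c).N n 0 ≤ (returnBound (system c).N n 0).toNat :=
    Int.self_le_toNat _
  filter_upwards [eventually_code_minPath_eq c (n + (returnBound (system c).N n 0).toNat)]
    with c' hc'
  exact ⟨fun x hx => exists_mem_subshift_window hR hc' hx,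
    fun x hx => exists_mem_subshift_window (c := c') (n := n) hR (fun j hj => (hc' j hj).symm) hx⟩

theorem exists_uniform_window {K U : Set Cantor} (hK : IsCompact K) (hU : IsOpen U)
    (h : K ⊆ U) : ∃ n : ℕ, ∀ x ∈ K, ∀ y : Cantor, (∀ j : ℤ, j.natAbs ≤ n → y j = x j) → y ∈ U := by
  choose! n hn using fun x (hx : x ∈ K) => mem_nhds_iff_window.1 (hU.mem_nhds (h hx))
  obtain ⟨t, ht, hcover⟩ := hK.elim_nhds_subcover
    (fun x => {y | ∀ j : ℤ, j.natAbs ≤ n x → y j = x j})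
    fun x _ => mem_nhds_iff_window.2 ⟨n x, fun y hy => hy⟩
  refine ⟨t.sup n, fun x hx y hy => ?_⟩
  obtain ⟨x', hx', hxx'⟩ := Set.mem_iUnion₂.1 (hcover hx)
  exact hn x' (ht x' hx') y fun j hj =>
    (hy j (hj.trans (Finset.le_sup hx'))).trans (hxx' j hj)

theorem continuous_subshift : Continuous fun c => (system c).subshift := by
  refine continuous_induced_rng.2 (continuous_generateFrom_iff.2 ?_)
  rintro s (⟨U, hU, rfl⟩ | ⟨U, hU, rfl⟩)
  · refine isOpen_iff_mem_nhds.2 fun c hc => ?_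
    obtain ⟨n, hn⟩ := exists_uniform_window (system c).subshift.isCompact hU hc
    filter_upwards [exists_eventually_window c n] with c' hc' y hy
    obtain ⟨x, hx, hxy⟩ := hc'.2 y hy
    exact hn x hx y fun j hj => (hxy j hj).symm
  · refine isOpen_iff_mem_nhds.2 fun c hc => ?_
    obtain ⟨x, hx, hxU⟩ := hc
    obtain ⟨n, hn⟩ := mem_nhds_iff_window.1 (IsOpen.mem_nhds (s := U) hU hxU)
    filter_upwards [exists_eventually_window c n] with c' hc'
    obtain ⟨y, hy, hxy⟩ := hc'.1 x hx
    exact ⟨y, hy, hn y hxy⟩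

theorem measurable_subshift_inflate :
    Measurable fun a : ℕ → ℕ → Bool => (system (inflate a)).subshift :=
  (continuous_subshift.comp (continuous_pi fun _ => continuous_apply _)).measurable

end ToeplitzSystem

namespace ToeplitzSystem

/-! ### The invariant measure and its arithmetic -/

theorem card_bit_eq_true {q : ℕ} (hq : 16 ≤ q) (hq5 : q % 5 = 1) (b v : Bool) :
    ((Finset.range q).filter fun d => bit q b v d = true).card =
      (q - 1) / 5 + (if v then 1 else 0) + (if b then 1 else 0) := by
  have h : ((Finset.range q).filter fun d => bit q b v d = true) =
      ((Finset.range ((q - 1) / 5)).image fun k => 5 * k) ∪ (if v then {7} else ∅) ∪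
        (if b then {12} else ∅) := by
    ext d
    simp only [Finset.mem_filter, Finset.mem_range, Finset.mem_union, Finset.mem_image]
    have h1 : (∃ k < (q - 1) / 5, 5 * k = d) ↔ d % 5 = 0 ∧ d + 1 < q :=
      ⟨fun ⟨k, hk, hd⟩ => by omega, fun ⟨h, h'⟩ => ⟨d / 5, by omega, by omega⟩⟩
    rw [h1]
    unfold bit
    cases b <;> cases v <;> by_cases h7 : d = 7 <;> by_cases h12 : d = 12 <;> simp [h7, h12] <;>
      omega
  have hd1 : Disjoint ((Finset.range ((q - 1) / 5)).image fun k => 5 * k)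
      (if v then {7} else ∅) := by
    rw [Finset.disjoint_left]
    intro d hd
    obtain ⟨k, -, rfl⟩ := Finset.mem_image.1 hd
    cases v <;> simp
    omega
  have hd2 : Disjoint (((Finset.range ((q - 1) / 5)).image fun k => 5 * k) ∪
      (if v then {7} else ∅)) (if b then {12} else ∅) := by
    rw [Finset.disjoint_left]
    intro d hd
    rcases Finset.mem_union.1 hd with hd | hd
    · obtain ⟨k, -, rfl⟩ := Finset.mem_image.1 hd
      cases b <;> simp
      omega
    · cases v
      · simp at hd
      · cases b <;> simp_all
  rw [h, Finset.card_union_of_disjoint hd2, Finset.card_union_of_disjoint hd1,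
    Finset.card_image_of_injective _ fun a b (hab : 5 * a = 5 * b) => by omega, Finset.card_range]
  cases b <;> cases v <;> simp

/-- The number of occurrences of `u` in the word attached to `v`. -/
def bitCount (q : ℕ) (b v u : Bool) : ℕ := (Finset.univ.filter fun d : Fin q => bit q b v d = u).card

theorem bitCount_true {q : ℕ} (hq : 16 ≤ q) (hq5 : q % 5 = 1) (b v : Bool) :
    (bitCount q b v true : ℝ) = (q - 1) / 5 + (if v then 1 else 0) + (if b then 1 else 0) := by
  have h : bitCount q b v true = ((Finset.range q).filter fun d => bit q b v d = true).card := by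
    rw [bitCount, ← Finset.card_map Fin.valEmbedding]
    congr 1
    ext d
    simp only [Finset.mem_map, Finset.mem_filter, Finset.mem_univ, true_and, Finset.mem_range]
    exact ⟨fun ⟨e, he, hd⟩ => hd ▸ ⟨e.2, he⟩, fun ⟨hd, h⟩ => ⟨⟨d, hd⟩, h, rfl⟩⟩
  rw [h, card_bit_eq_true hq hq5]
  obtain ⟨k, hk⟩ : ∃ k, q = 5 * k + 1 := ⟨q / 5, by omega⟩
  rw [show (q - 1) / 5 = k by omega, hk]
  push_cast
  ring

theorem bitCount_false (q : ℕ) (b v : Bool) :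
    (bitCount q b v false : ℝ) = q - bitCount q b v true := by
  have h := Finset.card_filter_add_card_filter_not (s := (Finset.univ : Finset (Fin q)))
    (fun d : Fin q => bit q b v d = true)
  simp only [Bool.not_eq_true, Finset.card_univ, Fintype.card_fin] at h
  have h' : bitCount q b v true + bitCount q b v false = q := h
  have : (bitCount q b v true + bitCount q b v false : ℝ) = q := by exact_mod_cast h'
  linarith

/-- The tail of the series defining the density of a letter. -/
noncomputable def densityTail (x : ℕ → Bool) (n : ℕ) : ℝ :=
  ∑' k, (if isPrefix x (k + n) then 1 else 0 : ℝ) / coordHeight (k + n + 1)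

theorem coordHeight_mul_pow_le (n k : ℕ) : coordHeight n * 2 ^ k ≤ coordHeight (k + n) := by
  induction k with
  | zero => simp
  | succ k ih =>
    rw [show k + 1 + n = k + n + 1 by ring, coordHeight_succ, pow_succ, ← mul_assoc]
    exact Nat.mul_le_mul ih ((by norm_num : 2 ≤ 16).trans (sixteen_le_coordLength _))

theorem densityTail_term_bounds (x : ℕ → Bool) (n k : ℕ) :
    0 ≤ (if isPrefix x (k + n) then 1 else 0 : ℝ) / coordHeight (k + n + 1) ∧
    (if isPrefix x (k + n) then 1 else 0 : ℝ) / coordHeight (k + n + 1) ≤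
      1 / coordHeight (n + 1) * (1 / 2) ^ k := by
  have h0 : (0 : ℝ) < coordHeight (n + 1) := by exact_mod_cast coordHeight_pos _
  have h1 : (0 : ℝ) < coordHeight (k + n + 1) := by exact_mod_cast coordHeight_pos _
  have h2 : (coordHeight (n + 1) * 2 ^ k : ℝ) ≤ coordHeight (k + n + 1) := by
    exact_mod_cast coordHeight_mul_pow_le (n + 1) k
  refine ⟨by positivity, ?_⟩
  calc (if isPrefix x (k + n) then 1 else 0 : ℝ) / coordHeight (k + n + 1)
      ≤ 1 / coordHeight (k + n + 1) := by
        gcongr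
        split_ifs <;> norm_num
    _ ≤ 1 / (coordHeight (n + 1) * 2 ^ k) := one_div_le_one_div_of_le (by positivity) h2
    _ = _ := by rw [one_div_pow, one_div_mul_one_div]

theorem summable_geometric_bound (n : ℕ) :
    Summable fun k : ℕ => 1 / (coordHeight (n + 1) : ℝ) * (1 / 2) ^ k :=
  (summable_geometric_of_lt_one (by norm_num) (by norm_num)).mul_left _

theorem summable_densityTail (x : ℕ → Bool) (n : ℕ) :
    Summable fun k => (if isPrefix x (k + n) then 1 else 0 : ℝ) / coordHeight (k + n + 1) :=
  Summable.of_nonneg_of_le (fun k => (densityTail_term_bounds x n k).1)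
    (fun k => (densityTail_term_bounds x n k).2) (summable_geometric_bound n)

theorem densityTail_nonneg (x : ℕ → Bool) (n : ℕ) : 0 ≤ densityTail x n :=
  tsum_nonneg fun k => (densityTail_term_bounds x n k).1

theorem densityTail_le (x : ℕ → Bool) (n : ℕ) : densityTail x n ≤ 2 / coordHeight (n + 1) := by
  have h := (summable_densityTail x n).tsum_le_tsum (fun k => (densityTail_term_bounds x n k).2)
    (summable_geometric_bound n)
  rw [tsum_mul_left, tsum_geometric_of_lt_one (by norm_num) (by norm_num)] at h
  refine h.trans_eq ?_
  ring

theorem densityTail_eq_sum_add (x : ℕ → Bool) (m : ℕ) : densityTail x 0 =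
    ∑ k ∈ Finset.range m, (if isPrefix x k then 1 else 0 : ℝ) / coordHeight (k + 1) +
      densityTail x m :=
  ((summable_densityTail x 0).sum_add_tsum_nat_add m).symm

theorem densityTail_succ (x : ℕ → Bool) (m : ℕ) : densityTail x m =
    (if isPrefix x m then 1 else 0 : ℝ) / coordHeight (m + 1) + densityTail x (m + 1) := by
  have h1 := densityTail_eq_sum_add x m
  have h2 := densityTail_eq_sum_add x (m + 1)
  rw [Finset.sum_range_succ] at h2
  linarith

/-- The conditional density of the letter `true`. -/
noncomputable def density (x : ℕ → Bool) (n : ℕ) : ℝ := 1 / 5 + coordHeight n * densityTail x n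

theorem coordLength_mul_density (x : ℕ → Bool) (n : ℕ) : coordLength n * density x n =
    (coordLength n - 1) / 5 + (if isPrefix x n then 1 else 0) + density x (n + 1) := by
  have h0 : (0 : ℝ) < coordHeight n := by exact_mod_cast coordHeight_pos _
  have h1 : (0 : ℝ) < coordLength n := by
    exact_mod_cast lt_of_lt_of_le (by norm_num) (sixteen_le_coordLength n)
  rw [density, density, densityTail_succ, coordHeight_succ]
  push_cast
  field_simp
  ring

theorem density_nonneg (x : ℕ → Bool) (n : ℕ) : 0 ≤ density x n := by
  have := densityTail_nonneg x n
  rw [density]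
  positivity

theorem density_le_one (x : ℕ → Bool) (n : ℕ) : density x n ≤ 1 := by
  have h0 : (0 : ℝ) < coordHeight n := by exact_mod_cast coordHeight_pos _
  have h1 : (16 : ℝ) ≤ coordLength n := by exact_mod_cast sixteen_le_coordLength n
  have h2 := mul_le_mul_of_nonneg_left (densityTail_le x n) h0.le
  rw [coordHeight_succ] at h2
  push_cast at h2
  have h3 : (coordHeight n : ℝ) * (2 / (coordHeight n * coordLength n)) ≤ 1 / 8 := by
    rw [← mul_div_assoc, mul_div_mul_left _ _ h0.ne', div_le_div_iff₀ (by linarith) (by norm_num)]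
    linarith
  rw [density]
  linarith

/-- The conditional density of a letter. -/
noncomputable def letterDensity (x : ℕ → Bool) (n : ℕ) (u : Bool) : ℝ :=
  if u then density x n else 1 - density x n

theorem letterDensity_nonneg (x : ℕ → Bool) (n : ℕ) (u : Bool) : 0 ≤ letterDensity x n u := by
  have := density_nonneg x n
  have := density_le_one x n
  unfold letterDensity
  split_ifs <;> linarith

theorem sum_letterDensity (x : ℕ → Bool) (n : ℕ) : ∑ u, letterDensity x n u = 1 := by
  simp [letterDensity]

theorem sum_bitCount_mul_letterDensity (x : ℕ → Bool) (n : ℕ) (u : Bool) :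
    ∑ v, bitCount (coordLength n) (isPrefix x n) v u * letterDensity x (n + 1) v =
      coordLength n * letterDensity x n u := by
  have h := coordLength_mul_density x n
  have ht := bitCount_true (sixteen_le_coordLength n) (coordLength_mod n) (isPrefix x n)
  cases u <;>
    simp only [Fintype.sum_bool, letterDensity, bitCount_false, ht, if_true, Bool.false_eq_true, if_false] <;>
    linarith

theorem count_system (c : ℕ → ℕ → Bool) (n : ℕ) (V : Vertex (n + 1)) (U : Vertex n) :
    (system c).count n V U =
      ∏ i, bitCount (coordSize n i) (isPrefix (c i) (n - i)) (V i.castSucc) (U i) := by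
  simp only [bitCount]
  rw [← Fintype.card_piFinset, count]
  refine (Finset.card_bij' (fun e _ => markSwap (V (Fin.last _)) (encode e))
    (fun t _ => decode n (markSwap (V (Fin.last _)) t)) ?_ ?_ ?_ ?_).symm
  · intro e he
    rw [Fintype.mem_piFinset] at he
    refine Finset.mem_filter.2 ⟨Finset.mem_Ico.2
      ⟨markSwap_nonneg (encode_nonneg _), markSwap_lt (encode_lt _)⟩, funext fun i => ?_⟩
    exact (subst_markSwap_encode c n V e i).trans (Finset.mem_filter.1 (he i)).2
  · intro t ht
    refine Fintype.mem_piFinset.2 fun i => Finset.mem_filter.2 ⟨Finset.mem_univ _, ?_⟩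
    exact congrFun (Finset.mem_filter.1 ht).2 i
  · intro e he
    rw [markSwap_markSwap, decode_encode]
  · intro t ht
    have h := Finset.mem_Ico.1 (Finset.mem_filter.1 ht).1
    rw [encode_decode (markSwap_nonneg h.1) (markSwap_lt h.2), markSwap_markSwap]

/-- The measure of the cylinders. -/
noncomputable def weight (c : ℕ → ℕ → Bool) (n : ℕ) (U : Vertex n) : ℝ :=
  (∏ i : Fin (n + 1), letterDensity (c i) (n - i) (U i)) / (system c).height n

theorem isWeight_weight (c : ℕ → ℕ → Bool) : (system c).IsWeight (weight c) := by
  have hh : ∀ n, (0 : ℝ) < (system c).height n := fun n => by exact_mod_cast (system c).height_pos n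
  refine ⟨fun n V => ?_, fun n => ?_, fun n U => ?_⟩
  · exact div_nonneg (Finset.prod_nonneg fun i _ => letterDensity_nonneg _ _ _) (hh n).le
  · simp only [weight]
    rw [← Finset.sum_div, mul_div_cancel₀ _ (hh n).ne', ← Fintype.piFinset_univ,
      ← Finset.prod_univ_sum (fun _ => Finset.univ) fun (i : Fin (n + 1)) u => letterDensity (c i) (n - i) u]
    exact Finset.prod_eq_one fun i _ => sum_letterDensity _ _
  · set F : Fin (n + 2) → Bool → ℝ := Fin.snoc (α := fun _ => Bool → ℝ) (fun (i : Fin (n + 1)) v =>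
      bitCount (coordSize n i) (isPrefix (c i) (n - i)) v (U i) * letterDensity (c i) (n - i + 1) v)
      (letterDensity (c (n + 1)) 0)
    have h1 : ∀ V : Vertex (n + 1), (system c).count n V U * weight c (n + 1) V =
        (∏ i, F i (V i)) / (system c).height (n + 1) := by
      intro V
      rw [weight, ← mul_div_assoc, count_system, Fin.prod_univ_castSucc (n := n + 1),
        Fin.prod_univ_castSucc (n := n + 1)]
      push_cast
      rw [← mul_assoc, ← Finset.prod_mul_distrib]
      simp only [F, Fin.snoc_castSucc, Fin.snoc_last, Nat.sub_self, Fin.val_castSucc]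
      have hi : ∀ i : Fin (n + 1), n + 1 - i = n - i + 1 := fun i => by have := i.2; omega
      simp only [hi]
    rw [Finset.sum_congr rfl fun V _ => h1 V, ← Finset.sum_div, ← Fintype.piFinset_univ,
      ← Finset.prod_univ_sum (fun _ => Finset.univ) F, Fin.prod_univ_castSucc]
    simp only [F, Fin.snoc_castSucc, Fin.snoc_last, sum_letterDensity, mul_one,
      sum_bitCount_mul_letterDensity]
    rw [Finset.prod_mul_distrib, weight, height]
    have hN : ((system c).N n : ℝ) = ∏ i : Fin (n + 1), (coordLength (n - i) : ℝ) := by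
      simp [system, stageLength]
    have hN0 : ((system c).N n : ℝ) ≠ 0 := by exact_mod_cast ((system c).N_pos n).ne'
    push_cast
    rw [← hN, mul_comm ((system c).N n : ℝ), mul_div_mul_right _ _ hN0]

end ToeplitzSystem

namespace ToeplitzSystem

/-- The numbers well approximated by fractions with denominator a fixed power of
`5 * coordHeight m`, for every `m` encoding a prefix of `x`. -/
def WellApproximated (x : ℕ → Bool) (s : ℝ) : Prop :=
  ∃ d : ℕ, ∃ C : ℝ, 0 ≤ C ∧ ∃ M : ℕ, ∀ m, M ≤ m → isPrefix x m = true →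
    ∃ A : ℤ, |s - A / (5 * coordHeight m) ^ d| ≤ C / coordHeight (m + 2)

theorem one_le_cast_coordHeight (m : ℕ) : (1 : ℝ) ≤ coordHeight m := by
  exact_mod_cast coordHeight_pos m

theorem wellApproximated_of_eq {x : ℕ → Bool} {s : ℝ} (d M : ℕ)
    (h : ∀ m, M ≤ m → ∃ A : ℤ, s = A / (5 * coordHeight m) ^ d) : WellApproximated x s := by
  refine ⟨d, 0, le_rfl, M, fun m hm _ => ?_⟩
  obtain ⟨A, hA⟩ := h m hm
  exact ⟨A, by rw [hA]; simp⟩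

theorem coordHeight_dvd {k m : ℕ} (h : k ≤ m) : coordHeight k ∣ coordHeight m := by
  induction m, h using Nat.le_induction with
  | base => exact dvd_rfl
  | succ m _ ih => exact ih.mul_right _

/-- The well approximated numbers form a ring. -/
def approximationRing (x : ℕ → Bool) : Subring ℝ where
  carrier := {s | WellApproximated x s}
  zero_mem' := wellApproximated_of_eq 0 0 fun m _ => ⟨0, by simp⟩
  one_mem' := wellApproximated_of_eq 0 0 fun m _ => ⟨1, by simp⟩
  neg_mem' := by
    rintro s ⟨d, C, hC, M, h⟩
    refine ⟨d, C, hC, M, fun m hm hx => ?_⟩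
    obtain ⟨A, hA⟩ := h m hm hx
    refine ⟨-A, ?_⟩
    rw [← abs_neg]
    refine le_of_eq_of_le ?_ hA
    congr 1
    push_cast
    ring
  add_mem' := by
    rintro s s' ⟨d, C, hC, M, h⟩ ⟨d', C', hC', M', h'⟩
    refine ⟨d + d', C + C', add_nonneg hC hC', max M M', fun m hm hx => ?_⟩
    obtain ⟨A, hA⟩ := h m (le_of_max_le_left hm) hx
    obtain ⟨A', hA'⟩ := h' m (le_of_max_le_right hm) hx
    have hH := one_le_cast_coordHeight m
    refine ⟨A * (5 * coordHeight m) ^ d' + A' * (5 * coordHeight m) ^ d, ?_⟩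
    rw [add_div]
    refine le_trans (le_of_eq_of_le ?_ (abs_add_le _ _)) (add_le_add hA hA')
    congr 1
    push_cast
    rw [pow_add]
    field_simp
    ring
  mul_mem' := by
    rintro s s' ⟨d, C, hC, M, h⟩ ⟨d', C', hC', M', h'⟩
    refine ⟨d + d', |s| * C' + C * (|s'| + C'), by positivity, max M M', fun m hm hx => ?_⟩
    obtain ⟨A, hA⟩ := h m (le_of_max_le_left hm) hx
    obtain ⟨A', hA'⟩ := h' m (le_of_max_le_right hm) hx
    have hH := one_le_cast_coordHeight m
    have hH2 := one_le_cast_coordHeight (m + 2)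
    refine ⟨A * A', ?_⟩
    set a : ℝ := A / (5 * coordHeight m) ^ d
    set a' : ℝ := A' / (5 * coordHeight m) ^ d'
    have he : ((A * A' : ℤ) : ℝ) / (5 * coordHeight m) ^ (d + d') = a * a' := by
      rw [pow_add, div_mul_div_comm]
      push_cast
      rfl
    have h1 : |a'| ≤ |s'| + C' := by
      have h2 : |a'| - |s'| ≤ |s' - a'| := by rw [abs_sub_comm]; exact abs_sub_abs_le_abs_sub _ _
      have h3 : C' / coordHeight (m + 2) ≤ C' := div_le_self hC' hH2
      linarith
    rw [he, show s * s' - a * a' = s * (s' - a') + (s - a) * a' by ring]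
    refine (abs_add_le _ _).trans ?_
    rw [abs_mul, abs_mul, add_div, mul_div_assoc, mul_div_right_comm]
    gcongr

theorem fifth_mem (x : ℕ → Bool) : (1 / 5 : ℝ) ∈ approximationRing x :=
  wellApproximated_of_eq 1 0 fun m _ => ⟨coordHeight m, by
    have hH := one_le_cast_coordHeight m
    push_cast
    field_simp⟩

theorem one_div_coordHeight_mem (x : ℕ → Bool) (k : ℕ) :
    (1 / coordHeight k : ℝ) ∈ approximationRing x :=
  wellApproximated_of_eq 1 k fun m hm => by
    obtain ⟨e, he⟩ := coordHeight_dvd hm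
    have hH := one_le_cast_coordHeight m
    have hk := one_le_cast_coordHeight k
    have he' : (coordHeight m : ℝ) = coordHeight k * e := by exact_mod_cast he
    have he0 : (e : ℝ) ≠ 0 := by
      rintro h
      rw [h, mul_zero] at he'
      linarith
    refine ⟨5 * e, ?_⟩
    rw [he']
    push_cast
    field_simp

theorem one_div_coordLength_mem (x : ℕ → Bool) (k : ℕ) :
    (1 / coordLength k : ℝ) ∈ approximationRing x := by
  have hk := one_le_cast_coordHeight k
  have hq : (1 : ℝ) ≤ coordLength k := by
    exact_mod_cast (by norm_num : 1 ≤ 16).trans (sixteen_le_coordLength k)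
  have h : (1 / coordLength k : ℝ) = coordHeight k * (1 / coordHeight (k + 1)) := by
    rw [coordHeight_succ]
    push_cast
    field_simp
  rw [h]
  exact mul_mem (natCast_mem _ _) (one_div_coordHeight_mem x _)

theorem exists_partial_sum (x : ℕ → Bool) (m : ℕ) : ∃ B : ℤ,
    ∑ k ∈ Finset.range m, (if isPrefix x k then 1 else 0 : ℝ) / coordHeight (k + 1) =
      B / coordHeight m := by
  have hH := one_le_cast_coordHeight m
  refine ⟨∑ k ∈ Finset.range m,
    (if isPrefix x k then ((coordHeight m / coordHeight (k + 1) : ℕ) : ℤ) else 0), ?_⟩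
  rw [Int.cast_sum, Finset.sum_div]
  refine Finset.sum_congr rfl fun k hk => ?_
  have hk' := one_le_cast_coordHeight (k + 1)
  split_ifs
  · rw [Int.cast_natCast, Nat.cast_div (coordHeight_dvd (Finset.mem_range.1 hk))
      (by positivity : (coordHeight (k + 1) : ℝ) ≠ 0)]
    field_simp
  · simp

theorem exists_not_isPrefix {x y : ℕ → Bool} (h : y ≠ x) :
    ∃ M, ∀ m, M ≤ m → isPrefix x m = true → isPrefix y m = false := by
  obtain ⟨j, hj⟩ := Function.ne_iff.1 h
  obtain ⟨M, hM⟩ := ((Finset.range (j + 1)).image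
    fun k => Encodable.encode ((List.range k).map x)).exists_nat_subset_range
  refine ⟨M, fun m hm hx => ?_⟩
  by_contra hy
  simp only [isPrefix, decide_eq_true_eq, Bool.not_eq_false] at hx hy
  obtain ⟨k, hk⟩ := hx
  obtain ⟨k', hk'⟩ := hy
  have he := Encodable.encode_injective (hk.trans hk'.symm)
  obtain rfl : k = k' := by simpa using congrArg List.length he
  have hkj : k ≤ j := by
    by_contra hcon
    exact hj (List.map_inj_left.1 he j (List.mem_range.2 (by omega))).symm
  have := Finset.mem_range.1 (hM (Finset.mem_image.2 ⟨k, Finset.mem_range.2 (by omega), hk⟩))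
  omega

theorem exists_isPrefix (x : ℕ → Bool) (M : ℕ) : ∃ m, M < m ∧ isPrefix x m = true := by
  have hinj : Function.Injective fun k => Encodable.encode ((List.range k).map x) := fun k l h => by
    simpa using congrArg List.length (Encodable.encode_injective h)
  obtain ⟨m, ⟨k, hk⟩, hm⟩ := (Set.infinite_range_of_injective hinj).exists_gt M
  exact ⟨m, hm, by simpa [isPrefix] using ⟨k, hk⟩⟩

theorem densityTail_mem {x y : ℕ → Bool} (h : y ≠ x) : densityTail y 0 ∈ approximationRing x := by
  obtain ⟨M, hM⟩ := exists_not_isPrefix h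
  refine ⟨1, 2, by norm_num, M, fun m hm hx => ?_⟩
  obtain ⟨B, hB⟩ := exists_partial_sum y m
  refine ⟨5 * B, ?_⟩
  have hH := one_le_cast_coordHeight m
  have h1 : ((5 * B : ℤ) : ℝ) / (5 * coordHeight m) ^ 1 = B / coordHeight m := by
    push_cast
    field_simp
  rw [h1, ← hB, densityTail_eq_sum_add y m, densityTail_succ y m, hM m hm hx, add_sub_cancel_left,
    if_neg (by simp), zero_div, zero_add, abs_of_nonneg (densityTail_nonneg _ _)]
  exact densityTail_le y (m + 1)

theorem coordLength_pow_bound (m : ℕ) : (m : ℝ) + 2 ≤ coordLength (m + 1) := by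
  have h1 : m + 2 ≤ 16 ^ (m + 2) := (Nat.lt_pow_self (by norm_num)).le
  exact_mod_cast h1.trans (pow_le_coordLength (m + 1))

theorem densityTail_notMem (x : ℕ → Bool) : densityTail x 0 ∉ approximationRing x := by
  rintro ⟨d, C, hC, M, h⟩
  obtain ⟨m, hm, hx⟩ := exists_isPrefix x (M + d + ⌈C⌉₊)
  obtain ⟨A, hA⟩ := h m (by omega) hx
  obtain ⟨B, hB⟩ := exists_partial_sum x m
  have hH := one_le_cast_coordHeight m
  have hH1 := one_le_cast_coordHeight (m + 1)
  have hH2 := one_le_cast_coordHeight (m + 2)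
  have hCm : C + 2 < coordLength (m + 1) := by
    have h1 : C ≤ ⌈C⌉₊ := Nat.le_ceil C
    have h2 : ((⌈C⌉₊ : ℕ) : ℝ) < m := by exact_mod_cast (by omega : ⌈C⌉₊ < m)
    have := coordLength_pow_bound m
    linarith
  have hH2' : (coordHeight (m + 2) : ℝ) = coordHeight (m + 1) * coordLength (m + 1) := by
    exact_mod_cast coordHeight_succ (m + 1)
  have hsmall : (C + 2) / coordHeight (m + 2) < 1 / coordHeight (m + 1) := by
    have hlen : (0 : ℝ) < coordLength (m + 1) := by linarith
    rw [hH2', div_lt_div_iff₀ (by positivity) (by positivity)]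
    nlinarith
  rw [densityTail_eq_sum_add x m, densityTail_succ x m, hx, if_pos rfl, hB] at hA
  have ht0 := densityTail_nonneg x (m + 1)
  have ht := densityTail_le x (m + 1)
  set K : ℤ := A * (5 * coordHeight m) - B * 5 * (5 * coordHeight m) ^ d with hK
  have hKr : (A : ℝ) / (5 * coordHeight m) ^ d - B / coordHeight m =
      K / (5 * coordHeight m) ^ (d + 1) := by
    rw [hK]
    push_cast
    field_simp
    ring
  have hmain : |(K : ℝ) / (5 * coordHeight m) ^ (d + 1) - 1 / coordHeight (m + 1)| ≤
      (C + 2) / coordHeight (m + 2) := by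
    rw [← hKr, add_div]
    rw [abs_le] at hA ⊢
    have : 0 ≤ C / coordHeight (m + 2) := by positivity
    constructor <;> linarith [hA.1, hA.2]
  rcases eq_or_ne K 0 with h0 | h0
  · rw [h0, Int.cast_zero, zero_div, zero_sub, abs_neg, abs_of_pos (by positivity)] at hmain
    linarith
  · have hK1 : (1 : ℝ) ≤ |(K : ℝ)| := by exact_mod_cast Int.one_le_abs h0
    have hlow : 1 / (5 * (coordHeight m : ℝ)) ^ (d + 1) ≤
        |(K : ℝ) / (5 * coordHeight m) ^ (d + 1)| := by
      rw [abs_div, abs_of_pos (by positivity : (0 : ℝ) < (5 * coordHeight m) ^ (d + 1))]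
      gcongr
    have hup : |(K : ℝ) / (5 * coordHeight m) ^ (d + 1)| ≤ 2 / coordHeight (m + 1) := by
      have h1 := abs_sub_abs_le_abs_sub ((K : ℝ) / (5 * coordHeight m) ^ (d + 1))
        (1 / coordHeight (m + 1))
      rw [abs_of_pos (by positivity : (0 : ℝ) < 1 / coordHeight (m + 1))] at h1
      rw [show (2 : ℝ) / coordHeight (m + 1) = 1 / coordHeight (m + 1) + 1 / coordHeight (m + 1) by ring]
      linarith
    have h2 := hlow.trans hup
    rw [div_le_div_iff₀ (by positivity) (by positivity), one_mul] at h2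
    have h3 : 2 * (5 * (coordHeight m : ℝ)) ^ (d + 1) ≤ (10 * coordHeight m) ^ (m + 1) := by
      calc 2 * (5 * (coordHeight m : ℝ)) ^ (d + 1)
          ≤ 2 ^ (d + 1) * (5 * (coordHeight m : ℝ)) ^ (d + 1) := by
            gcongr
            exact le_self_pow₀ (by norm_num) (by omega)
        _ = (10 * (coordHeight m : ℝ)) ^ (d + 1) := by rw [← mul_pow]; ring
        _ ≤ _ := pow_le_pow_right₀ (by linarith) (by omega)
    have h4 : (10 * (coordHeight m : ℝ)) ^ (m + 1) < (16 * coordHeight m) ^ (m + 1) :=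
      pow_lt_pow_left₀ (by linarith) (by positivity) (by omega)
    have h5 : (coordHeight (m + 1) : ℝ) = coordHeight m * (16 * coordHeight m) ^ (m + 1) := by
      rw [coordHeight]
      push_cast
      rfl
    have h6 : (16 * (coordHeight m : ℝ)) ^ (m + 1) ≤ coordHeight (m + 1) := by
      rw [h5]
      exact le_mul_of_one_le_left (by positivity) hH
    linarith

theorem density_zero (x : ℕ → Bool) : density x 0 = 1 / 5 + densityTail x 0 := by
  simp [density, coordHeight]

theorem density_mem {x y : ℕ → Bool} (h : y ≠ x) (n : ℕ) : density y n ∈ approximationRing x := by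
  induction n with
  | zero => exact density_zero y ▸ add_mem (fifth_mem x) (densityTail_mem h)
  | succ n ih =>
    have h1 : density y (n + 1) = coordLength n * density y n -
        ((coordLength n : ℝ) - 1) * (1 / 5) - (if isPrefix y n then 1 else 0) := by
      rw [coordLength_mul_density]
      ring
    rw [h1]
    refine sub_mem (sub_mem (mul_mem (natCast_mem _ _) ih)
      (mul_mem (sub_mem (natCast_mem _ _) (one_mem _)) (fifth_mem x))) ?_
    split_ifs
    exacts [one_mem _, zero_mem _]

theorem one_div_height_mem (x : ℕ → Bool) (c : ℕ → ℕ → Bool) (n : ℕ) :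
    (1 / (system c).height n : ℝ) ∈ approximationRing x := by
  induction n with
  | zero => simp [height]
  | succ n ih =>
    have hN : ((system c).N n : ℝ) = ∏ i : Fin (n + 1), (coordLength (n - i) : ℝ) := by
      simp [system, stageLength]
    have h : (1 / (system c).height (n + 1) : ℝ) =
        1 / (system c).height n * ∏ i : Fin (n + 1), (1 / coordLength (n - i) : ℝ) := by
      rw [height, Int.cast_mul, hN, Finset.prod_div_distrib, Finset.prod_const_one, div_mul_div_comm,
        one_mul]
    rw [h]
    exact mul_mem ih (prod_mem fun i _ => one_div_coordLength_mem x _)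

theorem weight_mem {x : ℕ → Bool} {c : ℕ → ℕ → Bool} (h : ∀ i, c i ≠ x) (n : ℕ) (U : Vertex n) :
    weight c n U ∈ approximationRing x := by
  rw [weight, div_eq_mul_one_div]
  refine mul_mem (prod_mem fun i _ => ?_) (one_div_height_mem x c n)
  unfold letterDensity
  split_ifs
  exacts [density_mem (h i) _, sub_mem (one_mem _) (density_mem (h i) _)]

theorem OrbitEquivalent.exists_eq_zero {c c' : ℕ → ℕ → Bool}
    (h : OrbitEquivalent (system c) (system c')) : ∃ i, c' i = c 0 := by
  by_contra! hne
  have h1 := h.measure_mem (isWeight_weight c) (isWeight_weight c')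
    (approximationRing (c 0)).toAddSubmonoid (weight_mem hne) fun _ => true
  have h2 : weight c 0 (fun _ => true) = 1 / 5 + densityTail (c 0) 0 := by
    simp [weight, letterDensity, density_zero, height]
  rw [h2] at h1
  refine densityTail_notMem (c 0) ?_
  have h3 := (approximationRing (c 0)).sub_mem h1 (fifth_mem (c 0))
  rwa [add_sub_cancel_left] at h3

theorem OrbitEquivalent.range_subset {c c' : ℕ → ℕ → Bool}
    (h : OrbitEquivalent (system c) (system c')) : Set.range c ⊆ Set.range c' := by
  rintro _ ⟨i, rfl⟩
  obtain ⟨j, hj⟩ := ((orbitEquivalent_comp_perm c (Equiv.swap 0 i)).symm.trans h).exists_eq_zero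
  exact ⟨j, by simpa using hj⟩

theorem orbitEquivalent_inflate_iff (a b : ℕ → ℕ → Bool) :
    OrbitEquivalent (system (inflate a)) (system (inflate b)) ↔ Set.range a = Set.range b := by
  refine ⟨fun h => ?_, fun h => ?_⟩
  · rw [← range_inflate a, ← range_inflate b]
    exact h.range_subset.antisymm h.symm.range_subset
  · obtain ⟨π, hπ⟩ := exists_perm_inflate h
    rw [hπ]
    exact (orbitEquivalent_comp_perm _ π).symm

end ToeplitzSystem

theorem stmt5 :
    ∃ T : (ℕ → (ℕ → Bool)) → NonemptyCompacts Cantor,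
      Measurable T ∧
      (∀ a, IsRegularToeplitzSubshift (T a : Set Cantor)) ∧
      ∀ a b : ℕ → (ℕ → Bool),
        (Set.range a = Set.range b ↔
          SubshiftOrbitEquivalent (T a : Set Cantor) (T b : Set Cantor)) := by
  refine ⟨fun a => (ToeplitzSystem.system (ToeplitzSystem.inflate a)).subshift,
    ToeplitzSystem.measurable_subshift_inflate,
    fun a => ToeplitzSystem.isRegularToeplitzSubshift _, fun a b => ?_⟩
  rw [← ToeplitzSystem.orbitEquivalent_iff, ToeplitzSystem.orbitEquivalent_inflate_iff]
end
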